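/- arXiv:q-alg/9606018 — 5 statements merged into one kernel-verified Lean document; each statement's English description precedes it below -/
import Mathlib

section
/- Define K̄u := det Wr(φ_1, …, φ_N, u), an entire function for each entire u. Suppose the polynomial x ↦ det Wr(φ_1, …, φ_N)(x) has n distinct roots μ_1, …, μ_n. Then: (a) for each k ∈ {1, …, n} there exists a unique γ′_k ∈ ℂ such that (K̄u)′(μ_k) + γ′_k·(K̄u)(μ_k) = 0 for every entire u; and (b) every finitely supported distribution annihilating the image of K̄ — i.e., every linear functional on entire functions of the form c(v) = Σ_{l=1}^m Σ_{j=0}^d a_{l,j}·v^{(j)}(ν_l) (a finite sum, with ν_l ∈ ℂ and a_{l,j} ∈ ℂ) satisfying c(K̄u) = 0 for all entire u — is a ℂ-linear combination of the n functionals v ↦ v′(μ_k) + γ′_k·v(μ_k). Thus C^β belongs to 𝔻(n) and is supported at the roots of the polynomial τ. -/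
open scoped BigOperators

/-- The generalized Airy operator `L₀ u = u^(r) - ∑_{k=1}^{r-2} a_k u^(k) - x·u`. -/
noncomputable def airyOp (r : ℕ) (a : ℕ → ℂ) (u : ℂ → ℂ) : ℂ → ℂ :=
  fun x => iteratedDeriv r u x
    - (∑ k ∈ Finset.Ico 1 (r - 1), a k * iteratedDeriv k u x) - x * u x

/-- The Wronskian determinant of an `m`-tuple of functions. -/
noncomputable def wrDet (m : ℕ) (g : Fin m → ℂ → ℂ) (x : ℂ) : ℂ :=
  Matrix.det (Matrix.of fun k s : Fin m => iteratedDeriv k.val (g s) x)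

/-- The bordered Wronskian determinant `det Wr(g₁, …, g_m, u)`. -/
noncomputable def wrDetB (m : ℕ) (g : Fin m → ℂ → ℂ) (u : ℂ → ℂ) (x : ℂ) : ℂ :=
  wrDet (m + 1) (Fin.snoc g u) x

/-- The family `φ_{i,j}(x) = γ_i·f_j(x+λ_i) + f_j'(x+λ_i)`, listed in a fixed order
as `φ_1, …, φ_N` with `N = r·n` (index `k` corresponds to `i = k / r`, `j = k % r`). -/
noncomputable def phiFam (r n : ℕ) (f : ℕ → ℂ → ℂ) (lam gam : ℕ → ℂ) :
    Fin (r * n) → ℂ → ℂ :=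
  fun k x => gam (k.val / r) * f (k.val % r) (x + lam (k.val / r)) +
    deriv (f (k.val % r)) (x + lam (k.val / r))

/-- The Vandermonde-type product `V = ∏_{i<j} (λ_i - λ_j)`. -/
noncomputable def vand (n : ℕ) (lam : ℕ → ℂ) : ℂ :=
  ∏ i ∈ Finset.range n, ∏ j ∈ Finset.Ico (i + 1) n, (lam i - lam j)

theorem differentiable_iteratedDeriv_of_entire {u : ℂ → ℂ} (hu : Differentiable ℂ u) (k : ℕ) :
    Differentiable ℂ (iteratedDeriv k u) :=
  (hu.contDiff (n := ((k + 1 : ℕ) : WithTop ℕ∞))).differentiable_iteratedDeriv k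
    (by exact_mod_cast k.lt_succ_self)

theorem hasDerivAt_iteratedDeriv_of_entire {u : ℂ → ℂ} (hu : Differentiable ℂ u) (k : ℕ) (x : ℂ) :
    HasDerivAt (iteratedDeriv k u) (iteratedDeriv (k + 1) u x) x := by
  rw [iteratedDeriv_succ]
  exact (differentiable_iteratedDeriv_of_entire hu k x).hasDerivAt

theorem iteratedDeriv_iteratedDeriv (i j : ℕ) (u : ℂ → ℂ) :
    iteratedDeriv i (iteratedDeriv j u) = iteratedDeriv (i + j) u := by
  simp only [iteratedDeriv_eq_iterate, Function.iterate_add_apply]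

theorem hasDerivAt_det {m : ℕ} {M : ℂ → Matrix (Fin m) (Fin m) ℂ} {M' : Matrix (Fin m) (Fin m) ℂ}
    {x : ℂ} (h : ∀ i j, HasDerivAt (fun y => M y i j) (M' i j) x) :
    HasDerivAt (fun y => (M y).det) (∑ i, ((M x).updateRow i (M' i)).det) x := by
  have hexp : ∀ A : Matrix (Fin m) (Fin m) ℂ,
      A.det = ∑ σ : Equiv.Perm (Fin m), (Equiv.Perm.sign σ : ℂ) * ∏ i, A i (σ i) := fun A => by
    rw [← Matrix.det_transpose, Matrix.det_apply']
    rfl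
  have hsum : (∑ i, ((M x).updateRow i (M' i)).det) =
      ∑ σ : Equiv.Perm (Fin m), (Equiv.Perm.sign σ : ℂ) *
        ∑ i, (∏ j ∈ Finset.univ.erase i, M x j (σ j)) • M' i (σ i) := by
    simp only [hexp, Finset.mul_sum]
    rw [Finset.sum_comm]
    refine Finset.sum_congr rfl fun σ _ => Finset.sum_congr rfl fun i _ => ?_
    rw [← Finset.mul_prod_erase _ _ (Finset.mem_univ i), Matrix.updateRow_self, smul_eq_mul,
      mul_comm (M' i (σ i))]
    congr 2
    refine Finset.prod_congr rfl fun j hj => ?_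
    rw [Matrix.updateRow_ne (Finset.ne_of_mem_erase hj)]
  rw [hsum, funext fun y => hexp (M y)]
  exact HasDerivAt.fun_sum fun σ _ =>
    (HasDerivAt.fun_finsetProd fun i _ => h i (σ i)).const_mul _

/-- The determinant whose rows are the derivatives of orders `0, …, m` except order `k`. -/
noncomputable def wrMinor {m : ℕ} (k : Fin (m + 1)) (g : Fin m → ℂ → ℂ) (x : ℂ) : ℂ :=
  Matrix.det (Matrix.of fun i s : Fin m => iteratedDeriv (k.succAbove i).val (g s) x)

theorem wrMinor_last {m : ℕ} (g : Fin m → ℂ → ℂ) (x : ℂ) :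
    wrMinor (Fin.last m) g x = wrDet m g x := by
  simp [wrMinor, wrDet]

theorem differentiable_det {m : ℕ} {M : ℂ → Matrix (Fin m) (Fin m) ℂ}
    (h : ∀ i j, Differentiable ℂ fun y => M y i j) : Differentiable ℂ fun y => (M y).det :=
  fun x => (hasDerivAt_det (M' := fun i j => deriv (fun y => M y i j) x)
    fun i j => (h i j x).hasDerivAt).differentiableAt

theorem differentiable_wrMinor {m : ℕ} (k : Fin (m + 1)) {g : Fin m → ℂ → ℂ}
    (hg : ∀ s, Differentiable ℂ (g s)) : Differentiable ℂ (wrMinor k g) :=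
  differentiable_det fun _ s => differentiable_iteratedDeriv_of_entire (hg s) _

theorem hasDerivAt_wrDet {m : ℕ} {g : Fin (m + 1) → ℂ → ℂ}
    (hg : ∀ s, Differentiable ℂ (g s)) (x : ℂ) :
    HasDerivAt (wrDet (m + 1) g) (wrMinor (Fin.last m).castSucc g x) x := by
  have h := hasDerivAt_det
    (M := fun y => Matrix.of fun k s : Fin (m + 1) => iteratedDeriv k.val (g s) y)
    (M' := Matrix.of fun k s : Fin (m + 1) => iteratedDeriv (k.val + 1) (g s) x) (x := x)
    fun i j => hasDerivAt_iteratedDeriv_of_entire (hg j) _ x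
  convert! h using 1
  rw [Finset.sum_eq_single (Fin.last m)]
  · unfold wrMinor
    congr 1
    ext k s
    induction k using Fin.lastCases with
    | last => simp [Fin.succAbove]
    | cast k =>
      rw [Matrix.updateRow_ne (Fin.castSucc_lt_last k).ne]
      simp [Fin.succAbove, Fin.lt_def]
  · intro i _ hi
    obtain ⟨k, rfl⟩ := Fin.exists_castSucc_eq.2 hi
    refine Matrix.det_zero_of_row_eq (i := k.castSucc) (j := k.succ)
      (Fin.castSucc_lt_succ).ne ?_
    rw [Matrix.updateRow_self, Matrix.updateRow_ne (Fin.castSucc_lt_succ).ne']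
    ext s
    simp
  · simp

theorem wrDetB_eq_sum {m : ℕ} (g : Fin m → ℂ → ℂ) (u : ℂ → ℂ) (x : ℂ) :
    wrDetB m g u x =
      ∑ k : Fin (m + 1), (-1) ^ (k.val + m) * wrMinor k g x * iteratedDeriv k.val u x := by
  rw [wrDetB, wrDet, Matrix.det_succ_column _ (Fin.last m)]
  refine Finset.sum_congr rfl fun k _ => ?_
  simp only [Matrix.of_apply, Fin.snoc_last, Fin.val_last, wrMinor]
  rw [mul_right_comm]
  congr 3
  ext i s
  simp [Fin.succAbove_last]

theorem wrDetB_succ {m : ℕ} {g : Fin (m + 1) → ℂ → ℂ} (hg : ∀ s, Differentiable ℂ (g s))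
    (u : ℂ → ℂ) (x : ℂ) :
    wrDetB (m + 1) g u x =
      (∑ k : Fin m, (-1) ^ (k.val + (m + 1)) * wrMinor k.castSucc.castSucc g x *
        iteratedDeriv k.val u x)
      - deriv (wrDet (m + 1) g) x * iteratedDeriv m u x
      + wrDet (m + 1) g x * iteratedDeriv (m + 1) u x := by
  rw [wrDetB_eq_sum, Fin.sum_univ_castSucc, Fin.sum_univ_castSucc, (hasDerivAt_wrDet hg x).deriv,
    ← wrMinor_last]
  have h1 : ((-1 : ℂ)) ^ (m + (m + 1)) = -1 := by
    rw [← add_assoc, pow_succ, ← two_mul, pow_mul]; simp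
  have h2 : ((-1 : ℂ)) ^ (m + 1 + (m + 1)) = 1 := by
    rw [← two_mul, pow_mul]; simp
  simp [h1, h2, sub_eq_add_neg]

theorem differentiable_snoc {m : ℕ} {g : Fin m → ℂ → ℂ} {u : ℂ → ℂ}
    (hg : ∀ s, Differentiable ℂ (g s)) (hu : Differentiable ℂ u) (s : Fin (m + 1)) :
    Differentiable ℂ ((Fin.snoc g u : Fin (m + 1) → ℂ → ℂ) s) := by
  induction s using Fin.lastCases with
  | last => simpa using hu
  | cast s => simpa using hg s

theorem mul_det_eq_of_sum_rows_eq_zero {m : ℕ} (A : Matrix (Fin (m + 1)) (Fin (m + 1)) ℂ)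
    (c : Fin (m + 1) → ℂ) (j : Fin (m + 1))
    (h : ∀ s : Fin m, ∑ k, c k * A k s.castSucc = 0) :
    c j * A.det = (-1) ^ (j.val + m) * (∑ k, c k * A k (Fin.last m)) *
      (A.submatrix j.succAbove Fin.castSucc).det := by
  rw [← smul_eq_mul, ← Matrix.det_updateRow_sum, Matrix.det_succ_row _ j,
    Fin.sum_univ_castSucc, Finset.sum_eq_zero, zero_add]
  · simp [Matrix.submatrix_updateRow_succAbove, Fin.succAbove_last, Finset.sum_apply]
  · intro s _
    simp [Finset.sum_apply, h s]

theorem deriv_wrDetB_mul {m : ℕ} {g : Fin (m + 1) → ℂ → ℂ}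
    (hg : ∀ s, Differentiable ℂ (g s)) {p : ℂ} (h0 : wrDet (m + 1) g p = 0)
    (h1 : deriv (wrDet (m + 1) g) p ≠ 0) :
    ∃ e : ℂ, ∀ u : ℂ → ℂ, Differentiable ℂ u →
      deriv (wrDetB (m + 1) g u) p * deriv (wrDet (m + 1) g) p = wrDetB (m + 1) g u p * e := by
  obtain ⟨c, hc0, hc⟩ := Matrix.exists_vecMul_eq_zero_iff.2 h0
  have hc : ∀ s, ∑ k : Fin (m + 1), c k * iteratedDeriv k.val (g s) p = 0 := fun s => by
    simpa [Matrix.vecMul, dotProduct] using congrFun hc s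
  rw [(hasDerivAt_wrDet hg p).deriv] at h1 ⊢
  have hcl : c (Fin.last m) ≠ 0 := by
    intro hcl
    refine h1 (Matrix.exists_vecMul_eq_zero_iff.1 ⟨c, hc0, ?_⟩)
    ext s
    refine Eq.trans ?_ (hc s)
    simp only [Matrix.vecMul, dotProduct, Fin.sum_univ_castSucc, hcl]
    simp [Fin.succAbove, Fin.lt_def]
  set j : Fin (m + 2) := (Fin.last m).castSucc with hj
  let R : Fin (m + 2) → ℕ := fun k => if k = Fin.last (m + 1) then m + 2 else k
  refine ⟨Matrix.det (Matrix.of fun k s : Fin (m + 1) => iteratedDeriv (R (j.succAbove k)) (g s) p),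
    fun u hu => ?_⟩
  have hl : ∀ (ρ : Fin (m + 2) → ℕ), (∀ k : Fin (m + 1), ρ k.castSucc = k.val) →
      c (Fin.last m) * Matrix.det (Matrix.of fun k s : Fin (m + 2) =>
        iteratedDeriv (ρ k) ((Fin.snoc g u : Fin (m + 2) → ℂ → ℂ) s) p) =
      (-1) ^ (m + (m + 1)) * (∑ k : Fin (m + 1), c k * iteratedDeriv k.val u p) *
        Matrix.det (Matrix.of fun k s : Fin (m + 1) =>
          iteratedDeriv (ρ (j.succAbove k)) (g s) p) := by
    intro ρ hρ
    have := mul_det_eq_of_sum_rows_eq_zero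
      (Matrix.of fun k s : Fin (m + 2) =>
        iteratedDeriv (ρ k) ((Fin.snoc g u : Fin (m + 2) → ℂ → ℂ) s) p)
      (Fin.snoc c 0) j (fun s => by
        rw [Fin.sum_univ_castSucc]
        simpa [hρ] using hc s)
    rw [Fin.sum_univ_castSucc] at this
    simp only [hj, Fin.snoc_castSucc, Fin.snoc_last, Matrix.of_apply, zero_mul, add_zero, hρ,
      Fin.val_castSucc, Fin.val_last] at this
    rw [this]
    congr 2
    ext k s
    simp [hj]
  have e0 := hl (fun k => k.val) (by simp)
  have e1 := hl R (by simp [R, Fin.ext_iff]; omega)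
  have hd : deriv (wrDetB (m + 1) g u) p = Matrix.det (Matrix.of fun k s : Fin (m + 2) =>
        iteratedDeriv (R k) ((Fin.snoc g u : Fin (m + 2) → ℂ → ℂ) s) p) := by
    have h := (hasDerivAt_wrDet (differentiable_snoc hg hu) p).deriv
    refine h.trans ?_
    unfold wrMinor
    congr 1
    ext k s
    simp only [Matrix.of_apply, R]
    congr 2
    induction k using Fin.lastCases with
    | last => simp [Fin.succAbove]
    | cast k => simp [Fin.succAbove, Fin.lt_def, Fin.ext_iff, k.is_lt.ne, Nat.lt_succ_iff.1 k.is_lt]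
  rw [← hd] at e1
  change _ * wrDetB (m + 1) g u p = _ * _ * wrMinor j g p at e0
  generalize Matrix.det (Matrix.of fun k s : Fin (m + 1) =>
    iteratedDeriv (R (j.succAbove k)) (g s) p) = E at e1 ⊢
  apply mul_left_cancel₀ hcl
  linear_combination wrMinor j g p * e1 - E * e0

theorem contDiffAt_of_entire {u : ℂ → ℂ} (hu : Differentiable ℂ u) (n : ℕ) (x : ℂ) :
    ContDiffAt ℂ n u x :=
  hu.contDiff.contDiffAt

theorem iteratedDeriv_mul_iteratedDeriv_of_vanishing {Q u : ℂ → ℂ} (hQ : Differentiable ℂ Q)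
    (hu : Differentiable ℂ u) {p : ℂ} {J : ℕ} (hv : ∀ t < J, iteratedDeriv t u p = 0) {i k : ℕ}
    (h : k + i = J) :
    iteratedDeriv i (fun x => Q x * iteratedDeriv k u x) p = Q p * iteratedDeriv J u p := by
  rw [iteratedDeriv_fun_mul (contDiffAt_of_entire hQ _ _)
    (contDiffAt_of_entire (differentiable_iteratedDeriv_of_entire hu k) _ _),
    Finset.sum_eq_single 0]
  · simp [iteratedDeriv_iteratedDeriv, ← h, add_comm]
  · intro l hl hl0
    rw [iteratedDeriv_iteratedDeriv, hv _ (by simp at hl; omega), mul_zero]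
  · simp

theorem iteratedDeriv_mul_iteratedDeriv_eq_zero {Q u : ℂ → ℂ} (hQ : Differentiable ℂ Q)
    (hu : Differentiable ℂ u) {p : ℂ} {J : ℕ} (hv : ∀ t < J, iteratedDeriv t u p = 0) {i k : ℕ}
    (h : k + i < J) :
    iteratedDeriv i (fun x => Q x * iteratedDeriv k u x) p = 0 := by
  rw [iteratedDeriv_mul_iteratedDeriv_of_vanishing hQ hu (fun t ht => hv t (ht.trans h)) rfl,
    hv _ h, mul_zero]

theorem iteratedDeriv_mul_iteratedDeriv_of_zero {Q u : ℂ → ℂ} (hQ : Differentiable ℂ Q)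
    (hu : Differentiable ℂ u) {p : ℂ} {J : ℕ} (hv : ∀ t < J, iteratedDeriv t u p = 0) {i k : ℕ}
    (h : k + i = J + 1) (hQp : Q p = 0) :
    iteratedDeriv i (fun x => Q x * iteratedDeriv k u x) p =
      i * deriv Q p * iteratedDeriv J u p := by
  rw [iteratedDeriv_fun_mul (contDiffAt_of_entire hQ _ _)
    (contDiffAt_of_entire (differentiable_iteratedDeriv_of_entire hu k) _ _)]
  cases i with
  | zero => simp [hQp]
  | succ i =>
    rw [Finset.sum_eq_single 1]
    · simp [iteratedDeriv_iteratedDeriv, show i + k = J by omega]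
    · intro l hl hl1
      rcases Nat.eq_zero_or_pos l with rfl | hl0
      · simp [hQp]
      · rw [iteratedDeriv_iteratedDeriv, hv _ (by simp at hl; omega), mul_zero]
    · simp

section
variable {m : ℕ} {g : Fin (m + 1) → ℂ → ℂ}

theorem differentiable_wrDet (hg : ∀ s, Differentiable ℂ (g s)) :
    Differentiable ℂ (wrDet (m + 1) g) :=
  fun x => (hasDerivAt_wrDet hg x).differentiableAt

theorem deriv_wrDet_eq (hg : ∀ s, Differentiable ℂ (g s)) :
    deriv (wrDet (m + 1) g) = wrMinor (Fin.last m).castSucc g :=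
  funext fun x => (hasDerivAt_wrDet hg x).deriv

theorem iteratedDeriv_wrDetB (hg : ∀ s, Differentiable ℂ (g s)) {u : ℂ → ℂ}
    (hu : Differentiable ℂ u) (i : ℕ) (p : ℂ) :
    iteratedDeriv i (wrDetB (m + 1) g u) p =
      (∑ k : Fin m, iteratedDeriv i (fun x => ((-1) ^ (k.val + (m + 1)) *
        wrMinor k.castSucc.castSucc g x) * iteratedDeriv k.val u x) p)
      - iteratedDeriv i (fun x => deriv (wrDet (m + 1) g) x * iteratedDeriv m u x) p
      + iteratedDeriv i (fun x => wrDet (m + 1) g x * iteratedDeriv (m + 1) u x) p := by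
  have hd : ∀ k, Differentiable ℂ (iteratedDeriv k u) := differentiable_iteratedDeriv_of_entire hu
  have hm : ∀ k, Differentiable ℂ (wrMinor k g) := fun k => differentiable_wrMinor k hg
  have h1 : ∀ k : Fin m, ContDiffAt ℂ i (fun x => ((-1) ^ (k.val + (m + 1)) *
      wrMinor k.castSucc.castSucc g x) * iteratedDeriv k.val u x) p := fun k =>
    contDiffAt_of_entire (((hm _).const_mul _).mul (hd _)) _ _
  have h2 : ContDiffAt ℂ i (fun x => deriv (wrDet (m + 1) g) x * iteratedDeriv m u x) p := by
    rw [deriv_wrDet_eq hg]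
    exact contDiffAt_of_entire ((hm _).mul (hd _)) _ _
  have h3 : ContDiffAt ℂ i (fun x => wrDet (m + 1) g x * iteratedDeriv (m + 1) u x) p :=
    contDiffAt_of_entire ((differentiable_wrDet hg).mul (hd _)) _ _
  rw [funext fun x => wrDetB_succ hg u x, iteratedDeriv_fun_add _ h3, iteratedDeriv_fun_sub _ h2,
    iteratedDeriv_fun_sum fun k _ => h1 k]
  · exact ContDiffAt.sum fun k _ => h1 k
  · exact (ContDiffAt.sum fun k _ => h1 k).sub h2

variable {u : ℂ → ℂ} {p : ℂ} {J i : ℕ}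

theorem iteratedDeriv_wrDetB_of_vanishing (hg : ∀ s, Differentiable ℂ (g s))
    (hu : Differentiable ℂ u) (hv : ∀ t < J, iteratedDeriv t u p = 0) (h : m + 1 + i = J) :
    iteratedDeriv i (wrDetB (m + 1) g u) p = wrDet (m + 1) g p * iteratedDeriv J u p := by
  have hm : ∀ k, Differentiable ℂ (wrMinor k g) := fun k => differentiable_wrMinor k hg
  rw [iteratedDeriv_wrDetB hg hu, deriv_wrDet_eq hg,
    iteratedDeriv_mul_iteratedDeriv_of_vanishing (differentiable_wrDet hg) hu hv h,
    iteratedDeriv_mul_iteratedDeriv_eq_zero (hm _) hu hv (by omega), Finset.sum_eq_zero]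
  · ring
  · intro k _
    exact iteratedDeriv_mul_iteratedDeriv_eq_zero ((hm _).const_mul _) hu hv (by omega)

theorem iteratedDeriv_wrDetB_eq_zero (hg : ∀ s, Differentiable ℂ (g s))
    (hu : Differentiable ℂ u) (hv : ∀ t < J, iteratedDeriv t u p = 0) (h : m + 1 + i < J) :
    iteratedDeriv i (wrDetB (m + 1) g u) p = 0 := by
  rw [iteratedDeriv_wrDetB_of_vanishing hg hu (fun t ht => hv t (ht.trans h)) rfl, hv _ h, mul_zero]

theorem iteratedDeriv_wrDetB_of_zero (hg : ∀ s, Differentiable ℂ (g s))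
    (hu : Differentiable ℂ u) (hv : ∀ t < J, iteratedDeriv t u p = 0) (h : m + i = J)
    (hp : wrDet (m + 1) g p = 0) :
    iteratedDeriv i (wrDetB (m + 1) g u) p =
      ((i : ℂ) - 1) * deriv (wrDet (m + 1) g) p * iteratedDeriv J u p := by
  have hm : ∀ k, Differentiable ℂ (wrMinor k g) := fun k => differentiable_wrMinor k hg
  have hd : Differentiable ℂ (deriv (wrDet (m + 1) g)) := by rw [deriv_wrDet_eq hg]; exact hm _
  rw [iteratedDeriv_wrDetB hg hu,
    iteratedDeriv_mul_iteratedDeriv_of_zero (differentiable_wrDet hg) hu hv (by omega) hp,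
    iteratedDeriv_mul_iteratedDeriv_of_vanishing hd hu hv h, Finset.sum_eq_zero]
  · ring
  · intro k _
    exact iteratedDeriv_mul_iteratedDeriv_eq_zero ((hm _).const_mul _) hu hv (by omega)

end

open Polynomial in
theorem Polynomial.iteratedDeriv_eval (P : ℂ[X]) (k : ℕ) :
    iteratedDeriv k (fun x => P.eval x) = fun x => (derivative^[k] P).eval x := by
  induction k with
  | zero => simp
  | succ k ih =>
    rw [iteratedDeriv_succ, ih, Function.iterate_succ_apply']
    funext x
    exact Polynomial.deriv _

open Polynomial in
theorem exists_entire_vanishing (S : Finset ℂ) (p : ℂ) (J M : ℕ) :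
    ∃ u : ℂ → ℂ, Differentiable ℂ u ∧ (∀ t < J, iteratedDeriv t u p = 0) ∧
      iteratedDeriv J u p ≠ 0 ∧ ∀ q ∈ S, q ≠ p → ∀ t < M, iteratedDeriv t u q = 0 := by
  set R : ℂ[X] := ∏ q ∈ S.erase p, (X - C q) ^ M with hR
  have hRp : R.eval p ≠ 0 := by
    rw [hR, eval_prod, Finset.prod_ne_zero_iff]
    intro q hq
    simpa using fun h => absurd (sub_eq_zero.1 h).symm (Finset.ne_of_mem_erase hq)
  have hR0 : R ≠ 0 := fun h => hRp (by simp [h])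
  have hmul : (R * (X - C p) ^ J).rootMultiplicity p = J := by
    rw [rootMultiplicity_mul_X_sub_C_pow hR0, rootMultiplicity_eq_zero hRp, zero_add]
  have hP0 : R * (X - C p) ^ J ≠ 0 := mul_ne_zero hR0 (pow_ne_zero _ (X_sub_C_ne_zero p))
  refine ⟨fun x => (R * (X - C p) ^ J).eval x, Polynomial.differentiable _, ?_, ?_, ?_⟩
  · intro t ht
    rw [Polynomial.iteratedDeriv_eval]
    exact isRoot_iterate_derivative_of_lt_rootMultiplicity (by rwa [hmul])
  · rw [Polynomial.iteratedDeriv_eval]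
    have h := eval_iterate_derivative_rootMultiplicity (p := R * (X - C p) ^ J) (t := p)
    have h' := eval_divByMonic_pow_rootMultiplicity_ne_zero p hP0
    rw [hmul] at h h'
    simp only [h]
    simpa [Nat.factorial_ne_zero] using h'
  · intro q hq hqp t ht
    rw [Polynomial.iteratedDeriv_eval]
    refine isRoot_iterate_derivative_of_lt_rootMultiplicity (ht.trans_le ?_)
    rw [le_rootMultiplicity_iff hP0]
    exact (Finset.dvd_prod_of_mem _ (Finset.mem_erase.2 ⟨hqp, hq⟩)).mul_right _

section
variable {m : ℕ} {g : Fin (m + 1) → ℂ → ℂ} {S : Finset ℂ} {D : ℕ} {B : ℂ → ℕ → ℂ} {p : ℂ}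

theorem exists_localized_test (hg : ∀ s, Differentiable ℂ (g s))
    (hann : ∀ u : ℂ → ℂ, Differentiable ℂ u →
      ∑ p ∈ S, ∑ j ∈ Finset.range D, B p j * iteratedDeriv j (wrDetB (m + 1) g u) p = 0)
    (hp : p ∈ S) (J : ℕ) :
    ∃ u : ℂ → ℂ, Differentiable ℂ u ∧ (∀ t < J, iteratedDeriv t u p = 0) ∧
      iteratedDeriv J u p ≠ 0 ∧
      ∑ j ∈ Finset.range D, B p j * iteratedDeriv j (wrDetB (m + 1) g u) p = 0 := by
  obtain ⟨u, hu, hv, hJ, hS⟩ := exists_entire_vanishing S p J (m + 1 + D)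
  refine ⟨u, hu, hv, hJ, ?_⟩
  have h := hann u hu
  rwa [Finset.sum_eq_single_of_mem p hp] at h
  intro q hq hqp
  refine Finset.sum_eq_zero fun j hj => ?_
  rw [iteratedDeriv_wrDetB_eq_zero hg hu (hS q hq hqp)
    (Nat.add_lt_add_left (Finset.mem_range.1 hj) _), mul_zero]

/-- A finitely supported distribution annihilating the image of `u ↦ det Wr(g₁, …, g_N, u)`, when
the Wronskian of `g` has only simple zeros, has no terms other than the first two at each zero. -/
theorem coeff_eq_zero_of_annihilates (hg : ∀ s, Differentiable ℂ (g s))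
    (hB : ∀ p, ∀ j, D ≤ j → B p j = 0)
    (hann : ∀ u : ℂ → ℂ, Differentiable ℂ u →
      ∑ p ∈ S, ∑ j ∈ Finset.range D, B p j * iteratedDeriv j (wrDetB (m + 1) g u) p = 0)
    (hsimple : ∀ p, wrDet (m + 1) g p = 0 → deriv (wrDet (m + 1) g) p ≠ 0)
    (hp : p ∈ S) {j : ℕ} (hj : wrDet (m + 1) g p = 0 → 2 ≤ j) : B p j = 0 := by
  obtain ⟨t, ht⟩ : ∃ t, D ≤ j + t := ⟨D, by omega⟩
  induction t generalizing j with
  | zero => exact hB p j ht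
  | succ t ih =>
    have hhigh : ∀ i, j < i → B p i = 0 := fun i hi =>
      ih (fun h => (hj h).trans hi.le) (by omega)
    have key : ∀ v : ℂ → ℂ, ∑ i ∈ Finset.range D, B p i * iteratedDeriv i v p = 0 →
        (∀ i < j, iteratedDeriv i v p = 0) → iteratedDeriv j v p ≠ 0 → B p j = 0 := by
      intro v hsum hlow hne
      rcases le_or_gt D j with h | h
      · exact hB p j h
      rw [Finset.sum_eq_single_of_mem j (Finset.mem_range.2 h)] at hsum
      · exact (mul_eq_zero.1 hsum).resolve_right hne
      · intro i _ hij
        rcases lt_or_gt_of_ne hij with hij | hij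
        · rw [hlow i hij, mul_zero]
        · rw [hhigh i hij, zero_mul]
    by_cases hW : wrDet (m + 1) g p = 0
    · obtain ⟨u, hu, hv, hJ, hsum⟩ := exists_localized_test hg hann hp (m + j)
      refine key _ hsum (fun i hi => ?_) ?_
      · rcases (show m + 1 + i ≤ m + j by omega).lt_or_eq with h | h
        · exact iteratedDeriv_wrDetB_eq_zero hg hu hv h
        · rw [iteratedDeriv_wrDetB_of_vanishing hg hu hv h, hW, zero_mul]
      · rw [iteratedDeriv_wrDetB_of_zero hg hu hv rfl hW]
        refine mul_ne_zero (mul_ne_zero (sub_ne_zero.2 ?_) (hsimple p hW)) hJ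
        have := hj hW
        exact_mod_cast (by omega : j ≠ 1)
    · obtain ⟨u, hu, hv, hJ, hsum⟩ := exists_localized_test hg hann hp (m + 1 + j)
      refine key _ hsum (fun i hi => ?_) ?_
      · exact iteratedDeriv_wrDetB_eq_zero hg hu hv (by omega)
      · rw [iteratedDeriv_wrDetB_of_vanishing hg hu hv rfl]
        exact mul_ne_zero hW hJ

theorem wrDetB_ne_zero (hg : ∀ s, Differentiable ℂ (g s)) (hW : wrDet (m + 1) g p = 0)
    (hW' : deriv (wrDet (m + 1) g) p ≠ 0) {u : ℂ → ℂ} (hu : Differentiable ℂ u)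
    (hv : ∀ t < m, iteratedDeriv t u p = 0) (hm : iteratedDeriv m u p ≠ 0) :
    wrDetB (m + 1) g u p ≠ 0 := by
  have h := iteratedDeriv_wrDetB_of_zero (i := 0) hg hu hv rfl hW
  rw [iteratedDeriv_zero] at h
  simp [h, hm, hW']

end

theorem sum_range_eq_two_terms (d : ℕ) (b x : ℕ → ℂ) (hb : ∀ j, 2 ≤ j → b j = 0) :
    ∑ j ∈ Finset.range (d + 2), b j * x j = b 0 * x 0 + b 1 * x 1 := by
  rw [Finset.sum_range_succ', Finset.sum_range_succ', Finset.sum_eq_zero]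
  · ring
  · intro j _
    rw [hb _ (by omega), zero_mul]

theorem annihilator_of_simple_zeros {N : ℕ} (hN : 0 < N) {g : Fin N → ℂ → ℂ}
    (hg : ∀ s, Differentiable ℂ (g s)) (n : ℕ) (mu : ℕ → ℂ)
    (hmu : ∀ k < n, ∀ l < n, k ≠ l → mu k ≠ mu l)
    (hroots : ∀ x : ℂ, wrDet N g x = 0 ↔ ∃ k < n, x = mu k)
    (hsimple : ∀ k < n, deriv (wrDet N g) (mu k) ≠ 0) :
    (∀ k < n, ∃! e : ℂ, ∀ u : ℂ → ℂ, Differentiable ℂ u →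
      deriv (wrDetB N g u) (mu k) + e * wrDetB N g u (mu k) = 0) ∧
    ∀ gam' : ℕ → ℂ,
      (∀ k < n, ∀ u : ℂ → ℂ, Differentiable ℂ u →
        deriv (wrDetB N g u) (mu k) + gam' k * wrDetB N g u (mu k) = 0) →
      ∀ (m d : ℕ) (nu : ℕ → ℂ) (A : ℕ → ℕ → ℂ),
        (∀ u : ℂ → ℂ, Differentiable ℂ u →
          ∑ l ∈ Finset.range m, ∑ j ∈ Finset.range (d + 1),
            A l j * iteratedDeriv j (wrDetB N g u) (nu l) = 0) →
        ∃ β : ℕ → ℂ, ∀ v : ℂ → ℂ, Differentiable ℂ v →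
          ∑ l ∈ Finset.range m, ∑ j ∈ Finset.range (d + 1),
              A l j * iteratedDeriv j v (nu l)
            = ∑ k ∈ Finset.range n, β k * (deriv v (mu k) + gam' k * v (mu k)) := by
  obtain ⟨N, rfl⟩ := Nat.exists_eq_add_one.2 hN
  have hzero : ∀ k < n, wrDet (N + 1) g (mu k) = 0 := fun k hk => (hroots _).2 ⟨k, hk, rfl⟩
  refine ⟨fun k hk => ?_, fun gam' hgam m d nu A hA => ?_⟩
  · obtain ⟨e, he⟩ := deriv_wrDetB_mul hg (hzero k hk) (hsimple k hk)
    obtain ⟨u, hu, hv, hne, -⟩ := exists_entire_vanishing ∅ (mu k) N 0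
    have hKu := wrDetB_ne_zero hg (hzero k hk) (hsimple k hk) hu hv hne
    refine ⟨-e / deriv (wrDet (N + 1) g) (mu k), fun w hw => ?_, fun e' he' => ?_⟩
    · have h := he w hw
      have := hsimple k hk
      field_simp
      linear_combination h
    · have h := he u hu
      have h' := he' u hu
      have := hsimple k hk
      field_simp
      apply mul_left_cancel₀ hKu
      linear_combination deriv (wrDet (N + 1) g) (mu k) * h' - h
  · set S : Finset ℂ := (Finset.range m).image nu ∪ (Finset.range n).image mu with hS
    let B : ℂ → ℕ → ℂ := fun p j =>
      if j < d + 1 then ∑ l ∈ Finset.range m with nu l = p, A l j else 0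
    have hcB : ∀ v : ℂ → ℂ,
        ∑ l ∈ Finset.range m, ∑ j ∈ Finset.range (d + 1), A l j * iteratedDeriv j v (nu l) =
        ∑ p ∈ S, ∑ j ∈ Finset.range (d + 2), B p j * iteratedDeriv j v p := by
      intro v
      rw [← Finset.sum_fiberwise_of_maps_to (s := Finset.range m) (t := S) (g := nu)
        fun l hl => Finset.mem_union_left _ (Finset.mem_image_of_mem _ hl)]
      refine Finset.sum_congr rfl fun p _ => ?_
      rw [Finset.sum_range_succ _ (d + 1), Finset.sum_comm]
      simp only [B, lt_irrefl, if_false, zero_mul, add_zero]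
      refine Finset.sum_congr rfl fun j hj => ?_
      rw [if_pos (Finset.mem_range.1 hj), Finset.sum_mul]
      exact Finset.sum_congr rfl fun l hl => by rw [(Finset.mem_filter.1 hl).2]
    have hB : ∀ p, ∀ j, d + 2 ≤ j → B p j = 0 := fun p j hj => if_neg (by omega)
    have hann := fun u hu => (hcB (wrDetB (N + 1) g u)).symm.trans (hA u hu)
    have hsimple' : ∀ p, wrDet (N + 1) g p = 0 → deriv (wrDet (N + 1) g) p ≠ 0 := by
      intro p hp
      obtain ⟨k, hk, rfl⟩ := (hroots p).1 hp
      exact hsimple k hk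
    have hmuS : ∀ k < n, mu k ∈ S := fun k hk =>
      Finset.mem_union_right _ (Finset.mem_image_of_mem _ (Finset.mem_range.2 hk))
    have hcoeff := fun (p : ℂ) (hp : p ∈ S) (j : ℕ) =>
      coeff_eq_zero_of_annihilates (j := j) hg hB hann hsimple' hp
    have hB0 : ∀ k < n, B (mu k) 0 = gam' k * B (mu k) 1 := by
      intro k hk
      obtain ⟨u, hu, hv, hne, hsum⟩ := exists_localized_test hg hann (hmuS k hk) N
      have hKu := wrDetB_ne_zero hg (hzero k hk) (hsimple k hk) hu hv hne
      rw [sum_range_eq_two_terms _ _ _ fun j hj => hcoeff _ (hmuS k hk) j fun _ => hj,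
        iteratedDeriv_zero, iteratedDeriv_one] at hsum
      apply mul_left_cancel₀ hKu
      linear_combination hsum - B (mu k) 1 * hgam k hk u hu
    refine ⟨fun k => B (mu k) 1, fun v _ => ?_⟩
    rw [hcB, ← Finset.sum_subset (Finset.subset_union_right), Finset.sum_image]
    · refine Finset.sum_congr rfl fun k hk => ?_
      have hk := Finset.mem_range.1 hk
      rw [sum_range_eq_two_terms _ _ _ fun j hj => hcoeff _ (hmuS k hk) j fun _ => hj,
        iteratedDeriv_zero, iteratedDeriv_one, hB0 k hk]
      ring
    · intro k hk l hl h
      by_contra hkl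
      exact hmu k (by simpa using hk) l (by simpa using hl) hkl h
    · intro p hp hpn
      refine Finset.sum_eq_zero fun j _ => ?_
      rw [hcoeff p hp j, zero_mul]
      intro hW
      obtain ⟨k, hk, rfl⟩ := (hroots p).1 hW
      exact absurd (Finset.mem_image_of_mem _ (Finset.mem_range.2 hk)) hpn

/-- `T` acts on entire functions as a linear differential operator with entire coefficients, of
order at most `m` and with the constant `s` as coefficient of the derivative of order `m`. -/
def IsDiffOperator (m : ℕ) (s : ℂ) (T : (ℂ → ℂ) → ℂ → ℂ) : Prop :=
  ∃ c : ℕ → ℂ → ℂ, (∀ k, Differentiable ℂ (c k)) ∧ ∀ u : ℂ → ℂ, Differentiable ℂ u → ∀ x,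
    T u x = s * iteratedDeriv m u x + ∑ k ∈ Finset.range m, c k x * iteratedDeriv k u x

namespace IsDiffOperator

variable {m : ℕ} {s t : ℂ} {T U : (ℂ → ℂ) → ℂ → ℂ}

theorem congr (hT : IsDiffOperator m s T)
    (h : ∀ u : ℂ → ℂ, Differentiable ℂ u → ∀ x, U u x = T u x) : IsDiffOperator m s U := by
  obtain ⟨c, hc, hT⟩ := hT
  exact ⟨c, hc, fun u hu x => (h u hu x).trans (hT u hu x)⟩

theorem id : IsDiffOperator 0 1 fun u => u :=
  ⟨0, fun _ => differentiable_const 0, by simp⟩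

theorem zero (m : ℕ) : IsDiffOperator m 0 fun _ _ => 0 :=
  ⟨0, fun _ => differentiable_const 0, by simp⟩

theorem add (hT : IsDiffOperator m s T) (hU : IsDiffOperator m t U) :
    IsDiffOperator m (s + t) fun u x => T u x + U u x := by
  obtain ⟨c, hc, hT⟩ := hT
  obtain ⟨d, hd, hU⟩ := hU
  refine ⟨fun k x => c k x + d k x, fun k => (hc k).add (hd k), fun u hu x => ?_⟩
  simp only [hT u hu x, hU u hu x, add_mul, Finset.sum_add_distrib]
  ring

theorem const_mul (a : ℂ) (hT : IsDiffOperator m s T) :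
    IsDiffOperator m (a * s) fun u x => a * T u x := by
  obtain ⟨c, hc, hT⟩ := hT
  refine ⟨fun k x => a * c k x, fun k => (hc k).const_mul a, fun u hu x => ?_⟩
  simp only [hT u hu x, mul_assoc, mul_add, Finset.mul_sum]

theorem mul_of_zero {q : ℂ → ℂ} (hq : Differentiable ℂ q) (hT : IsDiffOperator m 0 T) :
    IsDiffOperator m 0 fun u x => q x * T u x := by
  obtain ⟨c, hc, hT⟩ := hT
  refine ⟨fun k x => q x * c k x, fun k => hq.mul (hc k), fun u hu x => ?_⟩
  simp only [hT u hu x, mul_assoc, zero_mul, zero_add, Finset.mul_sum]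

theorem sum {ι : Type*} (I : Finset ι) {V : ι → (ℂ → ℂ) → ℂ → ℂ}
    (h : ∀ i ∈ I, IsDiffOperator m 0 (V i)) :
    IsDiffOperator m 0 fun u x => ∑ i ∈ I, V i u x := by
  classical
  induction I using Finset.induction_on with
  | empty => simpa using zero m
  | insert i I hi ih =>
    have := (h i (Finset.mem_insert_self i I)).add
      (ih fun j hj => h j (Finset.mem_insert_of_mem hj))
    rw [add_zero] at this
    exact this.congr fun u _ x => Finset.sum_insert hi

theorem raise_succ (hT : IsDiffOperator m s T) : IsDiffOperator (m + 1) 0 T := by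
  obtain ⟨c, hc, hT⟩ := hT
  refine ⟨fun k => if k < m then c k else fun _ => s, fun k => ?_, fun u hu x => ?_⟩
  · dsimp only
    split_ifs
    exacts [hc k, differentiable_const s]
  · dsimp only
    rw [hT u hu x, Finset.sum_range_succ, if_neg (lt_irrefl m), zero_mul, zero_add, add_comm]
    congr 1
    exact Finset.sum_congr rfl fun k hk => by rw [if_pos (Finset.mem_range.1 hk)]

theorem raise (hT : IsDiffOperator m s T) {l : ℕ} (hl : m < l) : IsDiffOperator l 0 T := by
  induction l, hl using Nat.le_induction with
  | base => exact hT.raise_succ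
  | succ l _ ih => exact ih.raise_succ

theorem deriv (hT : IsDiffOperator m s T) : IsDiffOperator (m + 1) s fun u => deriv (T u) := by
  obtain ⟨c, hc, hT⟩ := hT
  refine ⟨fun k x => (if k < m then _root_.deriv (c k) x else 0) +
    (if k = 0 then 0 else c (k - 1) x), fun k => Differentiable.add ?_ ?_, fun u hu x => ?_⟩
  · split_ifs
    · rw [← iteratedDeriv_one]
      exact differentiable_iteratedDeriv_of_entire (hc k) 1
    · exact differentiable_const 0
  · split_ifs
    exacts [differentiable_const 0, hc _]
  · have h : HasDerivAt (T u) (s * iteratedDeriv (m + 1) u x + ∑ k ∈ Finset.range m,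
        (_root_.deriv (c k) x * iteratedDeriv k u x + c k x * iteratedDeriv (k + 1) u x)) x := by
      rw [funext (hT u hu)]
      exact ((hasDerivAt_iteratedDeriv_of_entire hu m x).const_mul s).add
        (HasDerivAt.fun_sum fun k _ => ((hc k) x).hasDerivAt.mul
          (hasDerivAt_iteratedDeriv_of_entire hu k x))
    refine h.deriv.trans ?_
    congr 1
    simp only [add_mul, Finset.sum_add_distrib]
    congr 1
    · rw [Finset.sum_range_succ, if_neg (lt_irrefl m), zero_mul, add_zero]
      exact Finset.sum_congr rfl fun k hk => by rw [if_pos (Finset.mem_range.1 hk)]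
    · rw [Finset.sum_range_succ' (fun k => (if k = 0 then 0 else c (k - 1) x) * _)]
      simp

theorem iteratedDeriv (hT : IsDiffOperator m s T) (k : ℕ) :
    IsDiffOperator (m + k) s fun u => iteratedDeriv k (T u) := by
  induction k with
  | zero => simpa using hT
  | succ k ih => simpa only [iteratedDeriv_succ] using! ih.deriv

theorem airyOp {r : ℕ} (hr : 2 ≤ r) (a : ℕ → ℂ) (hT : IsDiffOperator m s T) :
    IsDiffOperator (m + r) s fun u => airyOp r a (T u) := by
  have h1 := hT.iteratedDeriv r
  have h2 : IsDiffOperator (m + r) 0 fun u x =>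
      ∑ k ∈ Finset.Ico 1 (r - 1), a k * _root_.iteratedDeriv k (T u) x := by
    refine sum _ fun k hk => ?_
    have := ((hT.iteratedDeriv k).raise (l := m + r)
      (by have := Finset.mem_Ico.1 hk; omega)).const_mul (a k)
    rwa [mul_zero] at this
  have h3 := (hT.raise (l := m + r) (by omega)).mul_of_zero differentiable_id
  have h := (h1.add (h2.const_mul (-1))).add (h3.const_mul (-1))
  simp only [mul_zero, add_zero] at h
  refine h.congr fun u _ x => ?_
  simp only [_root_.airyOp, _root_.id]
  ring

theorem iterate_airyOp {r : ℕ} (hr : 2 ≤ r) (a : ℕ → ℂ) (k : ℕ) :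
    IsDiffOperator (r * k) 1 fun u => (_root_.airyOp r a)^[k] u := by
  induction k with
  | zero => simpa using id
  | succ k ih => simpa only [Function.iterate_succ_apply', mul_add, mul_one] using ih.airyOp hr a

end IsDiffOperator

theorem wrDet_eq_det_of_isDiffOperator {N : ℕ} {T : ℕ → (ℂ → ℂ) → ℂ → ℂ}
    (hT : ∀ k, IsDiffOperator k 1 (T k)) {g : Fin N → ℂ → ℂ} (hg : ∀ s, Differentiable ℂ (g s))
    (x : ℂ) : wrDet N g x = Matrix.det (Matrix.of fun k s : Fin N => T k (g s) x) := by
  choose c _ hc using hT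
  let P : Matrix (Fin N) (Fin N) ℂ := Matrix.of fun k l =>
    if l < k then c k l x else if l = k then 1 else 0
  have hP : P.det = 1 := by
    rw [Matrix.det_of_isLowerTriangular]
    · simp [P]
    · intro i j hij
      have hij : i < j := hij
      simp [P, hij.not_gt, hij.ne']
  have hmul : (Matrix.of fun k s : Fin N => T k (g s) x) =
      P * Matrix.of fun k s : Fin N => iteratedDeriv k.val (g s) x := by
    ext k s
    simp only [Matrix.of_apply, Matrix.mul_apply, P, hc k _ (hg s) x, ite_mul, one_mul, zero_mul]
    have hfin := Fin.sum_univ_eq_sum_range (fun l => if l < k.val then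
      c k l x * iteratedDeriv l (g s) x else if l = k.val then iteratedDeriv l (g s) x else 0) N
    simp only [Fin.lt_def, Fin.ext_iff]
    rw [hfin, ← Finset.sum_subset (Finset.range_subset_range.2 k.is_lt), Finset.sum_range_succ,
      if_neg (lt_irrefl _), if_pos rfl, add_comm]
    · congr 1
      exact Finset.sum_congr rfl fun l hl => by rw [if_pos (Finset.mem_range.1 hl)]
    · intro l _ hl
      rw [Finset.mem_range] at hl
      rw [if_neg (by omega), if_neg (by omega)]
  rw [hmul, Matrix.det_mul, hP, one_mul]
  rfl

section
variable {r : ℕ} {a : ℕ → ℂ}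

theorem airyOp_linear_combination {u v : ℂ → ℂ} (hu : Differentiable ℂ u) (hv : Differentiable ℂ v)
    (c d : ℂ) :
    airyOp r a (fun x => c * u x + d * v x) = fun x => c * airyOp r a u x + d * airyOp r a v x := by
  have h : ∀ k x, iteratedDeriv k (fun x => c * u x + d * v x) x =
      c * iteratedDeriv k u x + d * iteratedDeriv k v x := fun k x => by
    rw [iteratedDeriv_fun_add (contDiffAt_of_entire (hu.const_mul c) _ _)
      (contDiffAt_of_entire (hv.const_mul d) _ _), iteratedDeriv_const_mul_field,
      iteratedDeriv_const_mul_field]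
  funext x
  simp only [airyOp, h, mul_add, Finset.sum_add_distrib, mul_left_comm _ c, mul_left_comm _ d,
    ← Finset.mul_sum]
  ring

theorem airyOp_comp_add {f : ℂ → ℂ} (hf : ∀ x, airyOp r a f x = 0) (l : ℂ) :
    airyOp r a (fun x => f (x + l)) = fun x => l * f (x + l) := by
  funext x
  have h := hf (x + l)
  simp only [airyOp, iteratedDeriv_comp_add_const] at h ⊢
  linear_combination h

theorem airyOp_deriv {u : ℂ → ℂ} (hu : Differentiable ℂ u) :
    airyOp r a (deriv u) = fun x => deriv (airyOp r a u) x + u x := by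
  funext x
  have hk : ∀ k, iteratedDeriv k (deriv u) = iteratedDeriv (k + 1) u := fun k =>
    iteratedDeriv_succ'.symm
  have h : HasDerivAt (airyOp r a u) (iteratedDeriv (r + 1) u x
      - (∑ k ∈ Finset.Ico 1 (r - 1), a k * iteratedDeriv (k + 1) u x)
      - (1 * u x + x * deriv u x)) x := by
    have hd := fun k => hasDerivAt_iteratedDeriv_of_entire hu k x
    exact ((hd r).sub (HasDerivAt.fun_sum fun k _ => (hd k).const_mul (a k))).sub
      ((hasDerivAt_id x).mul (hu x).hasDerivAt)
  rw [h.deriv, airyOp, hk]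
  simp only [hk]
  ring

theorem iterate_airyOp_eigenfunction {F : ℂ → ℂ} (hF : Differentiable ℂ F) {l : ℂ}
    (hl : airyOp r a F = fun x => l * F x) (γ : ℂ) (k : ℕ) :
    (airyOp r a)^[k] (fun x => γ * F x + deriv F x) =
      fun x => l ^ k * (γ * F x + deriv F x) + (k * l ^ (k - 1)) * F x := by
  have hF' : Differentiable ℂ (deriv F) := by
    simpa using differentiable_iteratedDeriv_of_entire hF 1
  have hφ : airyOp r a (fun x => γ * F x + deriv F x) =
      fun x => l * (γ * F x + deriv F x) + F x := by
    have h := airyOp_linear_combination (r := r) (a := a) hF hF' γ 1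
    simp only [one_mul] at h
    rw [h, airyOp_deriv hF, hl]
    funext x
    dsimp only
    rw [deriv_const_mul _ (hF x)]
    ring
  have hG : Differentiable ℂ fun x => γ * F x + deriv F x := (hF.const_mul γ).add hF'
  induction k with
  | zero => simp
  | succ k ih =>
    rw [Function.iterate_succ_apply', ih, airyOp_linear_combination hG hF,
      hφ, hl]
    funext x
    cases k with
    | zero => simp
    | succ k => push_cast; ring

theorem iteratedDeriv_combination_deriv {F : ℂ → ℂ} (hF : Differentiable ℂ F) (c γ d : ℂ)
    (b : ℕ) (x : ℂ) :
    iteratedDeriv b (fun x => c * (γ * F x + deriv F x) + d * F x) x =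
      c * (γ * iteratedDeriv b F x + iteratedDeriv (b + 1) F x) + d * iteratedDeriv b F x := by
  have hF' : Differentiable ℂ (deriv F) := by
    simpa using differentiable_iteratedDeriv_of_entire hF 1
  have hG : Differentiable ℂ fun x => γ * F x + deriv F x := (hF.const_mul γ).add hF'
  rw [iteratedDeriv_fun_add (contDiffAt_of_entire (hG.const_mul c) _ _)
    (contDiffAt_of_entire (hF.const_mul d) _ _), iteratedDeriv_const_mul_field,
    iteratedDeriv_const_mul_field, iteratedDeriv_fun_add
    (contDiffAt_of_entire (hF.const_mul γ) _ _) (contDiffAt_of_entire hF' _ _),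
    iteratedDeriv_const_mul_field, iteratedDeriv_succ']

end

open Polynomial in
/-- The polynomial matrix expressing multiplication by `d/dx` on the jet
`(F, F', …, F^(r-1))` of a solution of `L₀ F = l·F`. -/
noncomputable def airyCompanion (r : ℕ) (a : ℕ → ℂ) (l : ℂ) (b b' : Fin r) : ℂ[X] :=
  if b.val + 1 < r then (if b'.val = b.val + 1 then 1 else 0)
  else if b'.val = 0 then X + C l else if b'.val < r - 1 then C (a b'.val) else 0

open Polynomial in
theorem sum_airyCompanion {r : ℕ} (hr : 2 ≤ r) {a : ℕ → ℂ} {F : ℂ → ℂ} {l : ℂ}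
    (hl : airyOp r a F = fun x => l * F x) (b : Fin r) (x : ℂ) :
    ∑ b' : Fin r, (airyCompanion r a l b b').eval x * iteratedDeriv b'.val F x =
      iteratedDeriv (b.val + 1) F x := by
  by_cases hb : b.val + 1 < r
  · simp only [airyCompanion, if_pos hb]
    rw [Finset.sum_eq_single_of_mem ⟨b.val + 1, hb⟩ (Finset.mem_univ _)]
    · simp
    · intro b' _ h
      simp [Fin.ext_iff] at h
      simp [h]
  · obtain ⟨q, rfl⟩ := Nat.exists_eq_add_of_le' hr
    have hb' : b.val + 1 = q + 2 := by omega
    simp only [airyCompanion, if_neg hb]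
    rw [Fin.sum_univ_eq_sum_range (fun k => (if k = 0 then X + C l else if k < q + 2 - 1 then
      C (a k) else 0 : ℂ[X]).eval x * iteratedDeriv k F x) (q + 2), hb', Finset.range_eq_Ico,
      Finset.sum_Ico_succ_top (by omega), Finset.sum_eq_sum_Ico_succ_bot (by omega)]
    have h := congrFun hl x
    have hs : ∑ k ∈ Finset.Ico (0 + 1) (q + 1), (if k = 0 then X + C l else if k < q + 2 - 1 then
        C (a k) else 0 : ℂ[X]).eval x * iteratedDeriv k F x =
        ∑ k ∈ Finset.Ico 1 (q + 1), a k * iteratedDeriv k F x := by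
      refine Finset.sum_congr rfl fun k hk => ?_
      rw [Finset.mem_Ico] at hk
      rw [if_neg (by omega), if_pos (by omega), eval_C]
    rw [hs]
    simp only [airyOp, show q + 2 - 1 = q + 1 by omega] at h
    simp
    linear_combination -h

open Polynomial in
/-- The polynomial matrix relating the derivatives of order `b` of `L₀^k φ_{i,j}` to the jets of
the translates of the `f_j`; its determinant is the Wronskian of the `φ_{i,j}`. -/
noncomputable def airyPolyMatrix (r n : ℕ) (a lam gam : ℕ → ℂ) :
    Matrix (Fin r × Fin n) (Fin r × Fin n) ℂ[X] :=
  Matrix.of fun p q =>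
    C (lam q.2 ^ p.2.val) * (airyCompanion r a (lam q.2) p.1 q.1 +
      if p.1 = q.1 then C (gam q.2) else 0) +
    if p.1 = q.1 then C (p.2.val * lam q.2 ^ (p.2.val - 1)) else 0

open Polynomial in
theorem natDegree_airyCompanion_le {r : ℕ} (a : ℕ → ℂ) (l : ℂ) (b b' : Fin r) :
    (airyCompanion r a l b b').natDegree ≤ if b.val + 1 < r then 0 else 1 := by
  unfold airyCompanion
  split_ifs <;> simp

open Polynomial in
theorem natDegree_det_airyPolyMatrix_le (r n : ℕ) (a lam gam : ℕ → ℂ) :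
    (airyPolyMatrix r n a lam gam).det.natDegree ≤ n := by
  have hentry : ∀ p q, (airyPolyMatrix r n a lam gam p q).natDegree ≤
      if p.1.val + 1 < r then 0 else 1 := by
    intro p q
    have hc : ∀ c : ℂ, (if p.1 = q.1 then C c else 0 : ℂ[X]).natDegree ≤
        if p.1.val + 1 < r then 0 else 1 := fun c => by
      split_ifs <;> simp
    simp only [airyPolyMatrix, Matrix.of_apply]
    exact natDegree_add_le_of_degree_le ((natDegree_C_mul_le _ _).trans
      (natDegree_add_le_of_degree_le (natDegree_airyCompanion_le _ _ _ _) (hc _))) (hc _)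
  have hsum : ∑ p : Fin r × Fin n, (if p.1.val + 1 < r then 0 else 1) ≤ n := by
    rw [Fintype.sum_prod_type_right]
    refine (Finset.sum_le_card_nsmul _ _ 1 fun _ _ => ?_).trans (by simp)
    cases r with
    | zero => simp
    | succ r => simp [Fin.sum_univ_castSucc]
  rw [Matrix.det_apply]
  refine natDegree_sum_le_of_forall_le _ _ fun σ _ => ?_
  refine (natDegree_smul_le _ _).trans ((natDegree_prod_le _ _).trans ?_)
  refine (Finset.sum_le_sum fun p _ => hentry (σ p) p).trans ?_
  rwa [Equiv.sum_comp σ fun p : Fin r × Fin n => if p.1.val + 1 < r then 0 else 1]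

section
variable {r n : ℕ} {a : ℕ → ℂ} {f : ℕ → ℂ → ℂ}

theorem differentiable_phiFam (lam gam : ℕ → ℂ) (hr : 0 < r)
    (hf : ∀ j < r, Differentiable ℂ (f j)) (s : Fin (r * n)) :
    Differentiable ℂ (phiFam r n f lam gam s) := by
  have h := hf _ (Nat.mod_lt s.val hr)
  have h' := differentiable_iteratedDeriv_of_entire h 1
  rw [iteratedDeriv_one] at h'
  have ht : Differentiable ℂ fun x => x + lam (s.val / r) := differentiable_id.add_const _
  exact ((h.comp ht).const_mul _).add (h'.comp ht)

open Polynomial in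
theorem wrDet_phiFam_eq_eval (lam gam : ℕ → ℂ) (hr : 2 ≤ r)
    (hf : ∀ j < r, Differentiable ℂ (f j))
    (hker : ∀ j < r, ∀ x : ℂ, airyOp r a (f j) x = 0)
    (hwrf : ∀ x : ℂ, wrDet r (fun j => f j.val) x = 1) (x : ℂ) :
    wrDet (r * n) (phiFam r n f lam gam) x = (airyPolyMatrix r n a lam gam).det.eval x := by
  have hr0 : 0 < r := by omega
  let T : ℕ → (ℂ → ℂ) → ℂ → ℂ := fun k u => iteratedDeriv (k % r) ((airyOp r a)^[k / r] u)
  have hT : ∀ k, IsDiffOperator k 1 (T k) := fun k => by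
    have h := (IsDiffOperator.iterate_airyOp hr a (k / r)).iteratedDeriv (k % r)
    rwa [Nat.div_add_mod] at h
  rw [wrDet_eq_det_of_isDiffOperator hT (differentiable_phiFam lam gam hr0 hf)]
  let e : Fin r × Fin n ≃ Fin (r * n) :=
    ((Equiv.prodComm _ _).trans finProdFinEquiv).trans (finCongr (mul_comm n r))
  have he : ∀ p, (e p).val = p.1.val + r * p.2.val := fun p => rfl
  have hediv : ∀ p, (e p).val / r = p.2.val := fun p => by
    rw [he, Nat.add_mul_div_left _ _ hr0, Nat.div_eq_of_lt p.1.is_lt, zero_add]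
  have hemod : ∀ p, (e p).val % r = p.1.val := fun p => by
    rw [he, Nat.add_mul_mod_self_left, Nat.mod_eq_of_lt p.1.is_lt]
  let Wr : Fin n → Matrix (Fin r) (Fin r) ℂ := fun i =>
    Matrix.of fun b j => iteratedDeriv b.val (f j.val) (x + lam i)
  have hWr : (Matrix.blockDiagonal Wr).det = 1 := by
    rw [Matrix.det_blockDiagonal]
    exact Finset.prod_eq_one fun i _ => hwrf (x + lam i)
  rw [← Matrix.det_submatrix_equiv_self e, ← coe_evalRingHom, RingHom.map_det,
    ← mul_one (Matrix.det (RingHom.mapMatrix _ _)), ← hWr, ← Matrix.det_mul]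
  congr 1
  ext ⟨b, k⟩ ⟨j, i⟩
  rw [Matrix.mul_apply, Fintype.sum_prod_type]
  have hfj := hf j.val j.is_lt
  set F : ℂ → ℂ := fun y => f j.val (y + lam i) with hFdef
  have hF : Differentiable ℂ F := hfj.comp (differentiable_id.add_const _)
  have hl : airyOp r a F = fun y => lam i * F y := airyOp_comp_add (hker j.val j.is_lt) _
  have hFk : ∀ k y, iteratedDeriv k F y = iteratedDeriv k (f j.val) (y + lam i) := fun k y => by
    rw [hFdef, iteratedDeriv_comp_add_const]
  have hφ : phiFam r n f lam gam (e (j, i)) = fun y => gam i * F y + deriv F y := by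
    funext y
    have := hFk 1 y
    rw [iteratedDeriv_one, iteratedDeriv_one] at this
    simp only [phiFam, hediv, hemod]
    rw [this]
  have hsum : ∀ b' : Fin r, ∑ i' : Fin n,
      (evalRingHom x).mapMatrix (airyPolyMatrix r n a lam gam) (b, k) (b', i') *
        Matrix.blockDiagonal Wr (b', i') (j, i) =
      (lam i ^ k.val * ((airyCompanion r a (lam i) b b').eval x + if b = b' then gam i else 0) +
        if b = b' then k.val * lam i ^ (k.val - 1) else 0) * iteratedDeriv b'.val F x := by
    intro b'
    rw [Finset.sum_eq_single_of_mem i (Finset.mem_univ _)]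
    · simp only [Matrix.blockDiagonal_apply, Wr, Matrix.of_apply, if_true, hFk]
      congr 1
      simp only [RingHom.mapMatrix_apply, Matrix.map_apply, airyPolyMatrix, Matrix.of_apply,
        coe_evalRingHom]
      split_ifs <;> simp
    · intro i' _ hi
      simp [Matrix.blockDiagonal_apply, hi]
  simp only [hsum, add_mul, mul_add, mul_assoc, Finset.sum_add_distrib, ← Finset.mul_sum, ite_mul,
    zero_mul, Finset.sum_ite_eq, Finset.mem_univ, if_true, sum_airyCompanion hr hl]
  simp only [Matrix.submatrix_apply, Matrix.of_apply, T, hediv, hemod, hφ]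
  rw [iterate_airyOp_eigenfunction hF hl, iteratedDeriv_combination_deriv hF]
  ring

end

open Polynomial in
theorem eval_derivative_ne_zero_of_natDegree_le {P : ℂ[X]} {n : ℕ} (hP : P.natDegree ≤ n)
    {mu : ℕ → ℂ} (hmu : ∀ k < n, ∀ l < n, k ≠ l → mu k ≠ mu l)
    (hroots : ∀ x, P.eval x = 0 ↔ ∃ k < n, x = mu k) {k : ℕ} (hk : k < n) :
    P.derivative.eval (mu k) ≠ 0 := by
  classical
  have hP0 : P ≠ 0 := by
    rintro rfl
    refine Set.infinite_univ (α := ℂ) (((Finset.range n).image mu).finite_toSet.subset ?_)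
    intro x _
    obtain ⟨k, hk, rfl⟩ := (hroots x).1 (by simp)
    simpa using ⟨k, hk, rfl⟩
  have hsub : (Finset.range n).image mu ⊆ P.roots.toFinset := by
    intro x hx
    obtain ⟨k, hk, rfl⟩ := Finset.mem_image.1 hx
    simpa [hP0] using (hroots _).2 ⟨k, Finset.mem_range.1 hk, rfl⟩
  have hcard : ((Finset.range n).image mu).card = n := by
    rw [Finset.card_image_of_injOn, Finset.card_range]
    intro k hk l hl h
    by_contra hkl
    exact hmu k (by simpa using hk) l (by simpa using hl) hkl h
  have hnodup : P.roots.Nodup := by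
    rw [← Multiset.toFinset_card_eq_card_iff_nodup]
    refine le_antisymm (Multiset.toFinset_card_le _) ?_
    exact (P.card_roots'.trans hP).trans (hcard.symm.le.trans (Finset.card_le_card hsub))
  intro hd
  have h1 := (one_lt_rootMultiplicity_iff_isRoot hP0).2 ⟨(hroots _).2 ⟨k, hk, rfl⟩, hd⟩
  rw [← count_roots] at h1
  exact absurd (Multiset.nodup_iff_count_le_one.1 hnodup (mu k)) (by omega)

theorem statement7 (r n : ℕ) (a : ℕ → ℂ) (f : ℕ → ℂ → ℂ) (lam gam : ℕ → ℂ)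
    (hr : 2 ≤ r) (hn : 1 ≤ n)
    (hf : ∀ j < r, Differentiable ℂ (f j))
    (hker : ∀ j < r, ∀ x : ℂ, airyOp r a (f j) x = 0)
    (hwrf : ∀ x : ℂ, wrDet r (fun j => f j.val) x = 1)
    (hlam : ∀ i < n, ∀ j < n, i ≠ j → lam i ≠ lam j)
    (mu : ℕ → ℂ)
    (hmu : ∀ k < n, ∀ l < n, k ≠ l → mu k ≠ mu l)
    (hroots : ∀ x : ℂ, wrDet (r * n) (phiFam r n f lam gam) x = 0 ↔ ∃ k < n, x = mu k) :
    (∀ k < n, ∃! g : ℂ, ∀ u : ℂ → ℂ, Differentiable ℂ u →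
      deriv (wrDetB (r * n) (phiFam r n f lam gam) u) (mu k)
        + g * wrDetB (r * n) (phiFam r n f lam gam) u (mu k) = 0) ∧
    ∀ gam' : ℕ → ℂ,
      (∀ k < n, ∀ u : ℂ → ℂ, Differentiable ℂ u →
        deriv (wrDetB (r * n) (phiFam r n f lam gam) u) (mu k)
          + gam' k * wrDetB (r * n) (phiFam r n f lam gam) u (mu k) = 0) →
      ∀ (m d : ℕ) (nu : ℕ → ℂ) (A : ℕ → ℕ → ℂ),
        (∀ u : ℂ → ℂ, Differentiable ℂ u →
          ∑ l ∈ Finset.range m, ∑ j ∈ Finset.range (d + 1),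
            A l j * iteratedDeriv j (wrDetB (r * n) (phiFam r n f lam gam) u) (nu l) = 0) →
        ∃ β : ℕ → ℂ, ∀ v : ℂ → ℂ, Differentiable ℂ v →
          ∑ l ∈ Finset.range m, ∑ j ∈ Finset.range (d + 1),
              A l j * iteratedDeriv j v (nu l)
            = ∑ k ∈ Finset.range n, β k * (deriv v (mu k) + gam' k * v (mu k)) := by
  have hr0 : 0 < r := by omega
  have hW := fun x => wrDet_phiFam_eq_eval (n := n) lam gam hr hf hker hwrf x
  refine annihilator_of_simple_zeros (Nat.mul_pos hr0 hn) (differentiable_phiFam lam gam hr0 hf)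
    n mu hmu hroots fun k hk => ?_
  rw [funext hW, Polynomial.deriv]
  exact eval_derivative_ne_zero_of_natDegree_le (natDegree_det_airyPolyMatrix_le r n a lam gam) hmu
    (fun x => by rw [← hW, hroots]) hk
end

section
/- Let λ ∈ U with w(λ) = 0 and w′(λ) ≠ 0. Then there exists a unique γ ∈ ℂ such that (Qu)′(λ) + γ·(Qu)(λ) = 0 for every analytic function u on U. Moreover γ = (v(λ) − w″(λ)) / w′(λ). -/
open scoped BigOperators

/-- The determinant of the matrix whose rows are the derivatives of `(g_1, …, g_m)` of
orders `0, 1, …, m-3, m-1, m` (the coefficient `v` of `u^(m-2)` in the bordered Wronskian). -/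
noncomputable def vDet (m : ℕ) (g : Fin m → ℂ → ℂ) (x : ℂ) : ℂ :=
  Matrix.det (Matrix.of fun k s : Fin m =>
    iteratedDeriv (if k.val < m - 2 then k.val else k.val + 1) (g s) x)

/-- The derivative of a determinant is the sum over the rows of the determinants in which that
row is differentiated. -/
theorem hasDerivAt_det_of {n : Type*} [Fintype n] [DecidableEq n] {A : n → n → ℂ → ℂ}
    {A' : n → n → ℂ} {x : ℂ} (hA : ∀ k s, HasDerivAt (A k s) (A' k s) x) :
    HasDerivAt (fun y => Matrix.det (Matrix.of fun k s => A k s y))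
      (∑ i, Matrix.det (Matrix.of fun k s => if k = i then A' k s else A k s x)) x := by
  have h : HasDerivAt
      (fun y => ∑ σ : Equiv.Perm n, ((Equiv.Perm.sign σ : ℤ) : ℂ) * ∏ i, A i (σ i) y)
      (∑ σ : Equiv.Perm n, ((Equiv.Perm.sign σ : ℤ) : ℂ) *
        ∑ i, (∏ j ∈ Finset.univ.erase i, A j (σ j) x) • A' i (σ i)) x :=
    HasDerivAt.fun_sum fun σ _ =>
      (HasDerivAt.fun_finsetProd fun i _ => hA i (σ i)).const_mul _
  convert h using 1
  · funext y
    rw [← Matrix.det_transpose, Matrix.det_apply']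
    simp
  · simp_rw [Finset.mul_sum]
    rw [Finset.sum_comm]
    refine Finset.sum_congr rfl fun i _ => ?_
    rw [← Matrix.det_transpose, Matrix.det_apply']
    refine Finset.sum_congr rfl fun σ _ => ?_
    rw [← Finset.prod_erase_mul _ _ (Finset.mem_univ i)]
    simp only [Matrix.transpose_apply, Matrix.of_apply, if_true, smul_eq_mul]
    congr 2
    exact Finset.prod_congr rfl fun j hj => if_neg (Finset.ne_of_mem_erase hj)

/-- The determinant whose rows are the derivatives of `f` of orders `σ 0, σ 1, …`. -/
noncomputable def rowsDet {n : ℕ} (σ : Fin n → ℕ) (f : Fin n → ℂ → ℂ) (x : ℂ) : ℂ :=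
  Matrix.det (Matrix.of fun k s => iteratedDeriv (σ k) (f s) x)

theorem rowsDet_eq_zero {n : ℕ} {σ : Fin n → ℕ} {i j : Fin n} (hij : i ≠ j) (h : σ i = σ j)
    (f : Fin n → ℂ → ℂ) (x : ℂ) : rowsDet σ f x = 0 :=
  Matrix.det_zero_of_row_eq hij (by funext s; simp [h])

theorem hasDerivAt_rowsDet {n : ℕ} (σ : Fin n → ℕ) {f : Fin n → ℂ → ℂ} {x : ℂ}
    (hf : ∀ s, AnalyticAt ℂ (f s) x) :
    HasDerivAt (rowsDet σ f) (∑ i, rowsDet (Function.update σ i (σ i + 1)) f x) x := by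
  have h : ∀ k s, HasDerivAt (iteratedDeriv (σ k) (f s)) (iteratedDeriv (σ k + 1) (f s) x) x := by
    intro k s
    rw [iteratedDeriv_succ, iteratedDeriv_eq_iterate]
    exact ((hf s).iterated_deriv (σ k)).differentiableAt.hasDerivAt
  refine (hasDerivAt_det_of h).congr_deriv (Eq.symm ?_)
  refine Finset.sum_congr rfl fun i _ => ?_
  unfold rowsDet
  congr 2
  funext k s
  by_cases hk : k = i
  · subst hk; simp
  · simp [hk]

/-- The orders `0, 1, …, p - 1, q`. -/
def lastOrder (p q : ℕ) (k : Fin (p + 1)) : ℕ := if k.val < p then k.val else q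

theorem wrDet_eq_rowsDet (p : ℕ) (f : Fin (p + 1) → ℂ → ℂ) :
    wrDet (p + 1) f = rowsDet (lastOrder p p) f := by
  funext x
  unfold wrDet rowsDet
  congr 2
  funext k s
  congr 1
  simp only [lastOrder]
  split_ifs <;> omega

theorem deriv_wrDet (p : ℕ) {f : Fin (p + 1) → ℂ → ℂ} {x : ℂ}
    (hf : ∀ s, AnalyticAt ℂ (f s) x) :
    deriv (wrDet (p + 1) f) x = rowsDet (lastOrder p (p + 1)) f x := by
  rw [wrDet_eq_rowsDet, (hasDerivAt_rowsDet _ hf).deriv, Finset.sum_eq_single (Fin.last p)]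
  · congr 1
    funext k
    refine Fin.lastCases ?_ (fun k => ?_) k
    · simp [lastOrder]
    · simp [lastOrder, Fin.castSucc_ne_last]
  · intro i _ hi
    have hi' : i.val < p := Fin.val_lt_last hi
    have hne : (⟨i.val + 1, by omega⟩ : Fin (p + 1)) ≠ i := by simp [Fin.ext_iff]
    refine rowsDet_eq_zero hne ?_ f x
    rw [Function.update_of_ne hne, Function.update_self]
    simp only [lastOrder]
    split_ifs <;> omega
  · simp

theorem deriv_deriv_wrDet (p : ℕ) {f : Fin (p + 2) → ℂ → ℂ} {x : ℂ}
    (hf : ∀ s, AnalyticAt ℂ (f s) x) :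
    deriv (deriv (wrDet (p + 2) f)) x =
      vDet (p + 2) f x + rowsDet (lastOrder (p + 1) (p + 3)) f x := by
  have hev : deriv (wrDet (p + 2) f) =ᶠ[nhds x] rowsDet (lastOrder (p + 1) (p + 2)) f := by
    filter_upwards [Filter.eventually_all.2 fun s => (hf s).eventually_analyticAt] with y hy
    exact deriv_wrDet (p + 1) hy
  rw [hev.deriv_eq, (hasDerivAt_rowsDet _ hf).deriv, Fin.sum_univ_castSucc,
    Fin.sum_univ_castSucc, Finset.sum_eq_zero, zero_add]
  · congr 1
    · unfold vDet rowsDet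
      congr 2
      funext k s
      congr 1
      simp only [Function.update_apply, lastOrder, Fin.ext_iff, Fin.val_castSucc, Fin.val_last]
      split_ifs <;> omega
    · congr 1
      funext k
      simp only [Function.update_apply, lastOrder, Fin.ext_iff, Fin.val_last]
      split_ifs <;> omega
  · intro i _
    have hne : (i.succ.castSucc : Fin (p + 2)) ≠ i.castSucc.castSucc := by simp [Fin.ext_iff]
    refine rowsDet_eq_zero hne ?_ f x
    rw [Function.update_of_ne hne, Function.update_self]
    simp only [lastOrder, Fin.val_castSucc, Fin.val_succ]
    split_ifs <;> omega

/-- A linear relation `c` among the first `p + 1` rows of the Wronskian matrix of `g` reduces the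
bordered determinant with last row of order `q` to a determinant of size `p + 1`. -/
theorem rowsDet_snoc_of_relation (p q : ℕ) (g : Fin (p + 1) → ℂ → ℂ) (u : ℂ → ℂ) (x : ℂ)
    (c : Fin (p + 1) → ℂ) (hc : ∀ s, ∑ k, c k * iteratedDeriv k.val (g s) x = 0) :
    c (Fin.last p) * rowsDet (lastOrder (p + 1) q) (Fin.snoc g u : Fin (p + 2) → ℂ → ℂ) x =
      -((∑ k, c k * iteratedDeriv k.val u x) * rowsDet (lastOrder p q) g x) := by
  set A : Matrix (Fin (p + 2)) (Fin (p + 2)) ℂ := Matrix.of fun k s =>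
    iteratedDeriv (lastOrder (p + 1) q k) ((Fin.snoc g u : Fin (p + 2) → ℂ → ℂ) s) x with hA
  set r : Fin (p + 2) := (Fin.last p).castSucc with hr
  have hrow := Matrix.det_updateRow_sum A r (Fin.snoc c 0 : Fin (p + 2) → ℂ)
  have hsum : (∑ k, (Fin.snoc c 0 : Fin (p + 2) → ℂ) k • A k) =
      Fin.snoc (α := fun _ => ℂ) (fun _ => 0) (∑ k, c k * iteratedDeriv k.val u x) := by
    funext s
    rw [Fin.sum_univ_castSucc]
    refine Fin.lastCases ?_ (fun s => ?_) s
    · simp [hA, lastOrder, Fin.is_le]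
    · simpa [hA, lastOrder, Fin.is_le] using hc s
  rw [hsum] at hrow
  have hcr : (Fin.snoc c 0 : Fin (p + 2) → ℂ) r = c (Fin.last p) := by simp [hr]
  rw [hcr, smul_eq_mul] at hrow
  change c (Fin.last p) * A.det = _
  rw [← hrow, Matrix.det_succ_row _ r, Fin.sum_univ_castSucc, Finset.sum_eq_zero, zero_add]
  · have hsub : (A.updateRow r (Fin.snoc (α := fun _ => ℂ) (fun _ => 0)
        (∑ k, c k * iteratedDeriv k.val u x))).submatrix r.succAbove (Fin.last (p + 1)).succAbove =
        Matrix.of fun k s => iteratedDeriv (lastOrder p q k) (g s) x := by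
      ext k s
      rw [Matrix.submatrix_apply, Matrix.updateRow_ne (Fin.succAbove_ne _ _)]
      simp only [hA, Matrix.of_apply, Fin.succAbove_last, Fin.snoc_castSucc]
      congr 1
      simp only [lastOrder, Fin.succAbove, hr, Fin.lt_def, Fin.val_castSucc, Fin.val_last]
      split_ifs <;> simp_all <;> omega
    rw [hsub]
    have hsign : (-1 : ℂ) ^ (r.val + (Fin.last (p + 1)).val) = -1 := by
      simp only [hr, Fin.val_castSucc, Fin.val_last]
      exact Odd.neg_one_pow ⟨p, by omega⟩
    rw [hsign, Matrix.updateRow_self, Fin.snoc_last, rowsDet]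
    ring
  · intro s _
    simp

/-- At a simple zero of the Wronskian there is a linear relation among the rows of the Wronskian
matrix which involves the last row. -/
theorem exists_relation (p : ℕ) (g : Fin (p + 1) → ℂ → ℂ) (x : ℂ)
    (h0 : wrDet (p + 1) g x = 0) (h1 : rowsDet (lastOrder p (p + 1)) g x ≠ 0) :
    ∃ c : Fin (p + 1) → ℂ, c (Fin.last p) ≠ 0 ∧
      ∀ s, ∑ k, c k * iteratedDeriv k.val (g s) x = 0 := by
  obtain ⟨c, hc0, hc⟩ := Matrix.exists_vecMul_eq_zero_iff.2 h0
  have hrel : ∀ s, ∑ k, c k * iteratedDeriv k.val (g s) x = 0 := fun s => by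
    simpa [Matrix.vecMul, dotProduct] using congrFun hc s
  refine ⟨c, fun hlast => h1 ?_, hrel⟩
  refine Matrix.exists_vecMul_eq_zero_iff.1 ⟨c, hc0, ?_⟩
  funext s
  have := hrel s
  rw [Fin.sum_univ_castSucc, hlast] at this
  simpa [Matrix.vecMul, dotProduct, Fin.sum_univ_castSucc, hlast, lastOrder] using this

/-- The relation evaluated on the function `(z - x) ^ p` only sees its last coefficient. -/
theorem sum_mul_iteratedDeriv_sub_pow (p : ℕ) (c : Fin (p + 1) → ℂ) (x : ℂ) :
    ∑ k, c k * iteratedDeriv k.val (fun z => (z - x) ^ p) x = c (Fin.last p) * p.factorial := by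
  have h : ∀ k : ℕ, iteratedDeriv k (fun z => (z - x) ^ p) x =
      p.descFactorial k * (x - x) ^ (p - k) := fun k => by
    rw [iteratedDeriv_comp_sub_const k (fun z : ℂ => z ^ p) x]
    exact iteratedDeriv_pow p k
  rw [Fin.sum_univ_castSucc, Finset.sum_eq_zero, zero_add, h]
  · simp [Nat.descFactorial_self]
  · intro k _
    rw [h, sub_self, zero_pow (by simp; omega)]
    simp

theorem statement8 (U : Set ℂ) (hU : IsOpen U) (hUc : IsConnected U)
    (m : ℕ) (hm : 2 ≤ m) (g : Fin m → ℂ → ℂ)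
    (hg : ∀ s : Fin m, DifferentiableOn ℂ (g s) U)
    (lam : ℂ) (hlamU : lam ∈ U)
    (hw0 : wrDet m g lam = 0)
    (hw1 : deriv (fun x => wrDet m g x) lam ≠ 0) :
    (∃! γ : ℂ, ∀ u : ℂ → ℂ, DifferentiableOn ℂ u U →
      deriv (fun x => wrDetB m g u x) lam + γ * wrDetB m g u lam = 0) ∧
    ∀ u : ℂ → ℂ, DifferentiableOn ℂ u U →
      deriv (fun x => wrDetB m g u x) lam +
          ((vDet m g lam - iteratedDeriv 2 (fun x => wrDet m g x) lam) /
              deriv (fun x => wrDet m g x) lam) * wrDetB m g u lam = 0 := by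
  obtain ⟨p, rfl⟩ := Nat.exists_eq_add_of_le' hm
  have hU' : U ∈ nhds lam := hU.mem_nhds hlamU
  have hga : ∀ s, AnalyticAt ℂ (g s) lam := fun s => (hg s).analyticAt hU'
  have hd : deriv (fun x => wrDet (p + 2) g x) lam = rowsDet (lastOrder (p + 1) (p + 2)) g lam :=
    deriv_wrDet (p + 1) hga
  have hdd : vDet (p + 2) g lam - iteratedDeriv 2 (fun x => wrDet (p + 2) g x) lam =
      -rowsDet (lastOrder (p + 1) (p + 3)) g lam := by
    have := deriv_deriv_wrDet p hga
    rw [iteratedDeriv_succ, iteratedDeriv_one, this]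
    ring
  rw [hd] at hw1
  rw [hd, hdd]
  obtain ⟨c, hc, hrel⟩ := exists_relation (p + 1) g lam hw0 hw1
  have hQ : ∀ u : ℂ → ℂ, c (Fin.last (p + 1)) * wrDetB (p + 2) g u lam =
      -((∑ k, c k * iteratedDeriv k.val u lam) * rowsDet (lastOrder (p + 1) (p + 2)) g lam) := by
    intro u
    rw [wrDetB, wrDet_eq_rowsDet]
    exact rowsDet_snoc_of_relation (p + 1) (p + 2) g u lam c hrel
  have hQ' : ∀ u : ℂ → ℂ, DifferentiableOn ℂ u U →
      c (Fin.last (p + 1)) * deriv (fun x => wrDetB (p + 2) g u x) lam =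
      -((∑ k, c k * iteratedDeriv k.val u lam) * rowsDet (lastOrder (p + 1) (p + 3)) g lam) := by
    intro u hu
    have hsa : ∀ s, AnalyticAt ℂ ((Fin.snoc g u : Fin (p + 3) → ℂ → ℂ) s) lam := fun s => by
      refine Fin.lastCases ?_ (fun s => ?_) s
      · simpa using hu.analyticAt hU'
      · simpa using hga s
    have : deriv (fun x => wrDetB (p + 2) g u x) lam =
        rowsDet (lastOrder (p + 2) (p + 3)) (Fin.snoc g u : Fin (p + 3) → ℂ → ℂ) lam :=
      deriv_wrDet (p + 2) hsa
    rw [this]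
    exact rowsDet_snoc_of_relation (p + 1) (p + 3) g u lam c hrel
  have hmain : ∀ u : ℂ → ℂ, DifferentiableOn ℂ u U →
      deriv (fun x => wrDetB (p + 2) g u x) lam +
        (-rowsDet (lastOrder (p + 1) (p + 3)) g lam / rowsDet (lastOrder (p + 1) (p + 2)) g lam) *
          wrDetB (p + 2) g u lam = 0 := by
    intro u hu
    refine (mul_eq_zero.1 ?_).resolve_left hc
    rw [mul_add, hQ' u hu, mul_left_comm, hQ u]
    field_simp
    ring
  refine ⟨⟨_, hmain, fun γ hγ => ?_⟩, hmain⟩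
  have hu : DifferentiableOn ℂ (fun z => (z - lam) ^ (p + 1)) U := by fun_prop
  have hne : wrDetB (p + 2) g (fun z => (z - lam) ^ (p + 1)) lam ≠ 0 := by
    intro h
    have := hQ fun z => (z - lam) ^ (p + 1)
    rw [h, sum_mul_iteratedDeriv_sub_pow, mul_zero, eq_comm, neg_eq_zero] at this
    exact mul_ne_zero (mul_ne_zero hc (Nat.cast_ne_zero.2 (Nat.factorial_ne_zero _))) hw1 this
  exact mul_right_cancel₀ hne (add_left_cancel ((hγ _ hu).trans (hmain _ hu).symm))
end

section
/- Suppose ψ_1, …, ψ_r are analytic functions on U×V such that Σ_{k=0}^r b_k(x)·∂_x^k ψ_i(x,z) = z·ψ_i(x,z) on U×V for each i = 1, …, r, and such that for every λ ∈ V the functions x ↦ ψ_1(x,λ), …, x ↦ ψ_r(x,λ) are linearly independent over ℂ. Then for any finitely many distinct points λ_1, …, λ_m ∈ V, any integer d ≥ 0 and any complex numbers a_{i,l,j} (1 ≤ i ≤ r, 1 ≤ l ≤ m, 0 ≤ j ≤ d): if Σ_{i,l,j} a_{i,l,j}·(∂_z^j ψ_i)(x, λ_l) = 0 for all x ∈ U,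 then a_{i,l,j} = 0 for all i, l, j. Equivalently, the map sending an r-tuple (c_1, …, c_r) of finitely supported distributions on V to the function Σ_i c_i(ψ_i) on U is injective. -/
open scoped BigOperators
open Filter Topology

/-- A function of two complex variables which is jointly continuous and separately holomorphic
on `U ×ˢ V`. -/
structure SeparatelyHolomorphic (U V : Set ℂ) (g : ℂ → ℂ → ℂ) : Prop where
  cont : ∀ x ∈ U, ∀ z ∈ V, ContinuousAt (fun p : ℂ × ℂ => g p.1 p.2) (x, z)
  left : ∀ z ∈ V, DifferentiableOn ℂ (fun x => g x z) U
  right : ∀ x ∈ U, DifferentiableOn ℂ (g x) V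

/-- The partial derivative in the first variable. -/
noncomputable def partialLeft (g : ℂ → ℂ → ℂ) : ℂ → ℂ → ℂ :=
  fun x z => deriv (fun t => g t z) x

/-- The partial derivative in the second variable. -/
noncomputable def partialRight (g : ℂ → ℂ → ℂ) : ℂ → ℂ → ℂ :=
  fun x z => deriv (g x) z

theorem partialLeft_iterate (g : ℂ → ℂ → ℂ) (k : ℕ) (x z : ℂ) :
    (partialLeft^[k] g) x z = iteratedDeriv k (fun t => g t z) x := by
  induction k generalizing x z with
  | zero => simp
  | succ k ih =>
    rw [Function.iterate_succ_apply', iteratedDeriv_succ]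
    simp only [partialLeft, ih]

theorem partialRight_iterate (g : ℂ → ℂ → ℂ) (j : ℕ) (x z : ℂ) :
    (partialRight^[j] g) x z = iteratedDeriv j (g x) z := by
  induction j generalizing x z with
  | zero => simp
  | succ j ih =>
    rw [Function.iterate_succ_apply', iteratedDeriv_succ]
    have : (partialRight^[j] g) x = iteratedDeriv j (g x) := funext fun z => ih x z
    simp only [partialRight, this]

namespace SeparatelyHolomorphic

variable {U V : Set ℂ} {g g' : ℂ → ℂ → ℂ}

theorem swap (hg : SeparatelyHolomorphic U V g) :
    SeparatelyHolomorphic V U (fun z x => g x z) where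
  cont z hz x hx :=
    ContinuousAt.comp' (g := fun p : ℂ × ℂ => g p.1 p.2) (f := Prod.swap) (x := (z, x))
      (hg.cont x hx z hz) continuous_swap.continuousAt
  left := hg.right
  right := hg.left

theorem continuousAt_partialRight (hU : IsOpen U) (hV : IsOpen V)
    (hg : SeparatelyHolomorphic U V g) {x z : ℂ} (hx : x ∈ U) (hz : z ∈ V) :
    ContinuousAt (fun p : ℂ × ℂ => partialRight g p.1 p.2) (x, z) := by
  have hloc : TendstoLocallyUniformlyOn (fun p : ℂ × ℂ => g p.1) (g x) (𝓝 (x, z)) V := by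
    rw [Metric.tendstoLocallyUniformlyOn_iff]
    intro ε hε w hw
    have h1 := Metric.continuousAt_iff'.1 (hg.cont x hx w hw) (ε / 2) (half_pos hε)
    rw [nhds_prod_eq] at h1
    obtain ⟨s, hs, t, ht, hst⟩ := Filter.mem_prod_iff.1 h1
    refine ⟨t, mem_nhdsWithin_of_mem_nhds ht, ?_⟩
    have h2 : ∀ᶠ p : ℂ × ℂ in 𝓝 (x, z), p.1 ∈ s := continuousAt_fst.preimage_mem_nhds hs
    filter_upwards [h2] with p hp y hy
    have ha : dist (g p.1 y) (g x w) < ε / 2 := hst (Set.mk_mem_prod hp hy)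
    have hb : dist (g x y) (g x w) < ε / 2 :=
      hst (Set.mk_mem_prod (mem_of_mem_nhds hs) hy)
    linarith [dist_triangle_right (g x y) (g p.1 y) (g x w)]
  have hd := hloc.deriv (by
    have : ∀ᶠ p : ℂ × ℂ in 𝓝 (x, z), p.1 ∈ U :=
      continuousAt_fst.preimage_mem_nhds (hU.mem_nhds hx)
    filter_upwards [this] with p hp using hg.right p.1 hp) hV
  have hc : ContinuousWithinAt (deriv (g x)) V z :=
    (((hg.right x hx).deriv hV).continuousOn) z hz
  refine tendsto_comp_of_locally_uniform_limit_within (F := fun p : ℂ × ℂ => deriv (g p.1))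
    (g := Prod.snd) hc ?_ fun u hu => hd u hu z hz
  rw [hV.nhdsWithin_eq hz]
  exact continuousAt_snd

theorem tendstoLocallyUniformlyOn_slope (hU : IsOpen U) (hV : IsOpen V)
    (hg : SeparatelyHolomorphic U V g) {z : ℂ} (hz : z ∈ V) :
    TendstoLocallyUniformlyOn (fun h x => h⁻¹ * (g x (z + h) - g x z))
      (fun x => partialRight g x z) (𝓝[≠] 0) U := by
  rw [Metric.tendstoLocallyUniformlyOn_iff]
  intro ε hε x hx
  have h1 := Metric.continuousAt_iff'.1 (hg.continuousAt_partialRight hU hV hx hz) (ε / 4)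
    (by positivity)
  rw [nhds_prod_eq] at h1
  obtain ⟨s, hs, t, ht, hst⟩ := Filter.mem_prod_iff.1 h1
  obtain ⟨δ, hδ, hball⟩ := Metric.mem_nhds_iff.1 (inter_mem ht (hV.mem_nhds hz))
  refine ⟨s ∩ U, mem_nhdsWithin_of_mem_nhds (inter_mem hs (hU.mem_nhds hx)), ?_⟩
  have hsmall : ∀ᶠ h : ℂ in 𝓝[≠] 0, h ∈ Metric.ball (0 : ℂ) δ :=
    mem_nhdsWithin_of_mem_nhds (Metric.ball_mem_nhds 0 hδ)
  filter_upwards [hsmall, self_mem_nhdsWithin] with h hh hne y hy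
  have hne : h ≠ 0 := hne
  have hderiv : ∀ w ∈ Metric.ball z δ, HasDerivWithinAt
      (fun w => g y w - partialRight g y z * w)
      (partialRight g y w - partialRight g y z) (Metric.ball z δ) w := by
    intro w hw
    have hd := ((hg.right y hy.2).differentiableAt (hV.mem_nhds (hball hw).2)).hasDerivAt
    simpa [partialRight] using
      (hd.fun_sub ((hasDerivAt_id' w).const_mul (partialRight g y z))).hasDerivWithinAt
  have hbound : ∀ w ∈ Metric.ball z δ,
      ‖partialRight g y w - partialRight g y z‖ ≤ ε / 2 := by
    intro w hw
    have ha : dist (partialRight g y w) (partialRight g x z) < ε / 4 :=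
      hst (Set.mk_mem_prod hy.1 (hball hw).1)
    have hb : dist (partialRight g y z) (partialRight g x z) < ε / 4 :=
      hst (Set.mk_mem_prod hy.1 (mem_of_mem_nhds ht))
    rw [← dist_eq_norm]
    linarith [dist_triangle_right (partialRight g y w) (partialRight g y z)
      (partialRight g x z)]
  have hmv := Convex.norm_image_sub_le_of_norm_hasDerivWithin_le hderiv hbound
    (convex_ball z δ) (Metric.mem_ball_self hδ) (y := z + h) (by simpa using hh)
  have hpos : 0 < ‖h‖ := norm_pos_iff.2 hne
  have heq : h⁻¹ * (g y (z + h) - g y z) - partialRight g y z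
      = h⁻¹ * ((g y (z + h) - partialRight g y z * (z + h))
        - (g y z - partialRight g y z * z)) := by
    field_simp
    ring
  rw [dist_comm, dist_eq_norm, heq, norm_mul, norm_inv, inv_mul_lt_iff₀ hpos]
  simp only [add_sub_cancel_left] at hmv
  nlinarith

theorem slope_differentiableOn (hV : IsOpen V)
    (hg : SeparatelyHolomorphic U V g) {z : ℂ} (hz : z ∈ V) :
    ∀ᶠ h : ℂ in 𝓝[≠] 0,
      z + h ∈ V ∧ DifferentiableOn ℂ (fun x => h⁻¹ * (g x (z + h) - g x z)) U := by
  have hmem : ∀ᶠ h : ℂ in 𝓝 0, z + h ∈ V := by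
    have : Tendsto (fun h : ℂ => z + h) (𝓝 0) (𝓝 z) := by
      simpa using (continuous_const_add z).tendsto 0
    exact this (hV.mem_nhds hz)
  filter_upwards [mem_nhdsWithin_of_mem_nhds hmem] with h hh
  exact ⟨hh, ((hg.left _ hh).sub (hg.left z hz)).const_mul _⟩

protected theorem partialRight (hU : IsOpen U) (hV : IsOpen V)
    (hg : SeparatelyHolomorphic U V g) : SeparatelyHolomorphic U V (partialRight g) where
  cont _ hx _ hz := hg.continuousAt_partialRight hU hV hx hz
  left _ hz := (hg.tendstoLocallyUniformlyOn_slope hU hV hz).differentiableOn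
    ((hg.slope_differentiableOn hV hz).mono fun _ h => h.2) hU
  right x hx := (hg.right x hx).deriv hV

protected theorem partialLeft (hU : IsOpen U) (hV : IsOpen V)
    (hg : SeparatelyHolomorphic U V g) : SeparatelyHolomorphic U V (partialLeft g) :=
  (hg.swap.partialRight hV hU).swap

theorem partialLeft_partialRight (hU : IsOpen U) (hV : IsOpen V)
    (hg : SeparatelyHolomorphic U V g) {x z : ℂ} (hx : x ∈ U) (hz : z ∈ V) :
    partialLeft (partialRight g) x z = partialRight (partialLeft g) x z := by
  have hslope := hg.slope_differentiableOn hV hz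
  have h1 := ((hg.tendstoLocallyUniformlyOn_slope hU hV hz).deriv
    (hslope.mono fun _ h => h.2) hU).tendsto_at hx
  refine (HasDerivAt.deriv (hasDerivAt_iff_tendsto_slope_zero.2 (h1.congr' ?_))).symm
  filter_upwards [hslope] with h hh
  have hd {w : ℂ} (hw : w ∈ V) : DifferentiableAt ℂ (fun x => g x w) x :=
    (hg.left w hw).differentiableAt (hU.mem_nhds hx)
  simp only [Function.comp_apply, smul_eq_mul, partialLeft]
  rw [deriv_const_mul _ ((hd hh.1).fun_sub (hd hz)), deriv_fun_sub (hd hh.1) (hd hz)]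

theorem iterate_partialRight (hU : IsOpen U) (hV : IsOpen V)
    (hg : SeparatelyHolomorphic U V g) (j : ℕ) :
    SeparatelyHolomorphic U V (partialRight^[j] g) := by
  induction j with
  | zero => exact hg
  | succ j ih =>
    rw [Function.iterate_succ_apply']
    exact ih.partialRight hU hV

theorem iterate_partialLeft (hU : IsOpen U) (hV : IsOpen V)
    (hg : SeparatelyHolomorphic U V g) (k : ℕ) :
    SeparatelyHolomorphic U V (partialLeft^[k] g) := by
  induction k with
  | zero => exact hg
  | succ k ih =>
    rw [Function.iterate_succ_apply']
    exact ih.partialLeft hU hV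

theorem partialLeft_iterate_partialRight (hU : IsOpen U) (hV : IsOpen V)
    (hg : SeparatelyHolomorphic U V g) (j : ℕ) :
    ∀ x ∈ U, ∀ z ∈ V,
      partialLeft (partialRight^[j] g) x z = (partialRight^[j] (partialLeft g)) x z := by
  induction j with
  | zero => intros; rfl
  | succ j ih =>
    intro x hx z hz
    rw [Function.iterate_succ_apply', Function.iterate_succ_apply',
      (hg.iterate_partialRight hU hV j).partialLeft_partialRight hU hV hx hz]
    exact Filter.EventuallyEq.deriv_eq
      (Filter.eventually_of_mem (hV.mem_nhds hz) fun w hw => ih x hx w hw)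

/-- Iterated partial derivatives of a separately holomorphic function commute. -/
theorem iterate_partialLeft_iterate_partialRight (hU : IsOpen U) (hV : IsOpen V)
    (hg : SeparatelyHolomorphic U V g) (j k : ℕ) :
    ∀ x ∈ U, ∀ z ∈ V,
      (partialLeft^[k] (partialRight^[j] g)) x z
        = (partialRight^[j] (partialLeft^[k] g)) x z := by
  induction k with
  | zero => intros; rfl
  | succ k ih =>
    intro x hx z hz
    rw [Function.iterate_succ_apply', Function.iterate_succ_apply',
      ← (hg.iterate_partialLeft hU hV k).partialLeft_iterate_partialRight hU hV j x hx z hz]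
    exact Filter.EventuallyEq.deriv_eq
      (Filter.eventually_of_mem (hU.mem_nhds hx) fun w hw => ih w hw z hz)

theorem contDiffAt_left (hU : IsOpen U) (hg : SeparatelyHolomorphic U V g) {x z : ℂ}
    (hx : x ∈ U) (hz : z ∈ V) {n : ℕ} : ContDiffAt ℂ n (fun t => g t z) x :=
  ((hg.left z hz).contDiffOn hU).contDiffAt (hU.mem_nhds hx)

theorem contDiffAt_right (hV : IsOpen V) (hg : SeparatelyHolomorphic U V g) {x z : ℂ}
    (hx : x ∈ U) (hz : z ∈ V) {n : ℕ} : ContDiffAt ℂ n (g x) z :=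
  ((hg.right x hx).contDiffOn hV).contDiffAt (hV.mem_nhds hz)

end SeparatelyHolomorphic

theorem SeparatelyHolomorphic.of_differentiableOn {U V : Set ℂ} (hU : IsOpen U) (hV : IsOpen V)
    {f : ℂ × ℂ → ℂ} (hf : DifferentiableOn ℂ f (U ×ˢ V)) :
    SeparatelyHolomorphic U V (fun x z => f (x, z)) where
  cont x hx z hz :=
    (hf.differentiableAt ((hU.prod hV).mem_nhds (Set.mk_mem_prod hx hz))).continuousAt
  left z hz := hf.comp (by fun_prop) fun x hx => Set.mk_mem_prod hx hz
  right x hx := hf.comp (by fun_prop) fun z hz => Set.mk_mem_prod hx hz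

theorem iteratedDeriv_fun_id_mul {g : ℂ → ℂ} {z : ℂ} {j : ℕ} (hg : ContDiffAt ℂ j g z) :
    iteratedDeriv j (fun w => w * g w) z
      = z * iteratedDeriv j g z + j * iteratedDeriv (j - 1) g z := by
  rw [iteratedDeriv_fun_mul contDiffAt_fun_id hg]
  rcases j with _ | j
  · simp
  · rw [Finset.sum_range_succ', Finset.sum_range_succ']
    simp [iteratedDeriv_fun_id]
    ring

/-- Differentiating the eigenvalue equation `L g = z g` in the spectral parameter `z` gives
`(L - z) ∂_z^j g = j ∂_z^(j-1) g`. -/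
theorem SeparatelyHolomorphic.sum_mul_iteratedDeriv_iteratedDeriv {U V : Set ℂ}
    (hU : IsOpen U) (hV : IsOpen V) {g : ℂ → ℂ → ℂ} (hg : SeparatelyHolomorphic U V g)
    {r : ℕ} {b : ℕ → ℂ → ℂ}
    (heig : ∀ x ∈ U, ∀ z ∈ V,
      ∑ k ∈ Finset.range (r + 1), b k x * iteratedDeriv k (fun t => g t z) x = z * g x z)
    {x z : ℂ} (hx : x ∈ U) (hz : z ∈ V) (j : ℕ) :
    ∑ k ∈ Finset.range (r + 1), b k x * iteratedDeriv k (fun t => iteratedDeriv j (g t) z) x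
      = z * iteratedDeriv j (g x) z + j * iteratedDeriv (j - 1) (g x) z := by
  rw [← iteratedDeriv_fun_id_mul (hg.contDiffAt_right hV hx hz)]
  have hev : (fun w => w * g x w) =ᶠ[𝓝 z]
      fun w => ∑ k ∈ Finset.range (r + 1), b k x * (partialLeft^[k] g) x w := by
    filter_upwards [hV.mem_nhds hz] with w hw
    simp only [partialLeft_iterate, heig x hx w hw]
  have hcd (k : ℕ) : ContDiffAt ℂ j ((partialLeft^[k] g) x) z :=
    (hg.iterate_partialLeft hU hV k).contDiffAt_right hV hx hz
  rw [hev.iteratedDeriv_eq j, iteratedDeriv_fun_sum fun k _ => contDiffAt_const.mul (hcd k)]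
  refine Finset.sum_congr rfl fun k _ => ?_
  rw [iteratedDeriv_const_mul_field, ← partialRight_iterate,
    ← hg.iterate_partialLeft_iterate_partialRight hU hV j k x hx z hz, partialLeft_iterate]
  simp only [partialRight_iterate]

/-- The adjoint action of `L` on coefficients of derivatives at the points `lam l`. -/
def coeffShift (lam : ℕ → ℂ) : Module.End ℂ (ℕ → ℕ → ℕ → ℂ) where
  toFun A i l j := lam l * A i l j + (j + 1) * A i l (j + 1)
  map_add' A B := by ext; simp; ring
  map_smul' c A := by ext; simp; ring

/-- The coefficient families supported on `i < r`, `l < m`, `j ≤ d`. -/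
def boundedCoeffs (r m d : ℕ) : Submodule ℂ (ℕ → ℕ → ℕ → ℂ) where
  carrier := {A | ∀ i l j, ¬ (i < r ∧ l < m ∧ j ≤ d) → A i l j = 0}
  add_mem' hA hB i l j h := by simp [hA i l j h, hB i l j h]
  zero_mem' _ _ _ _ := rfl
  smul_mem' c A hA i l j h := by simp [hA i l j h]

instance (r m d : ℕ) : FiniteDimensional ℂ (boundedCoeffs r m d) := by
  let f : boundedCoeffs r m d →ₗ[ℂ] (Fin r × Fin m × Fin (d + 1) → ℂ) :=
    { toFun A p := A.1 p.1 p.2.1 p.2.2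
      map_add' _ _ := rfl
      map_smul' _ _ := rfl }
  refine FiniteDimensional.of_injective f fun A B h => Subtype.ext ?_
  ext i l j
  by_cases hc : i < r ∧ l < m ∧ j ≤ d
  · exact congrFun h (⟨i, hc.1⟩, ⟨l, hc.2.1⟩, ⟨j, Nat.lt_succ_of_le hc.2.2⟩)
  · rw [A.2 i l j hc, B.2 i l j hc]

theorem coeffShift_mem_boundedCoeffs {r m d : ℕ} (lam : ℕ → ℂ) {A : ℕ → ℕ → ℕ → ℂ}
    (hA : A ∈ boundedCoeffs r m d) : coeffShift lam A ∈ boundedCoeffs r m d := by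
  intro i l j h
  have h1 := hA i l j h
  have h2 := hA i l (j + 1) (by omega)
  simp [coeffShift, h1, h2]

/-- An eigenvector of `coeffShift lam` is supported at a single `l` and at `j = 0`. -/
theorem exists_forall_ne_of_coeffShift_eq_smul {r m d : ℕ} {lam : ℕ → ℂ}
    (hlam : ∀ l < m, ∀ l' < m, l ≠ l' → lam l ≠ lam l') {A : ℕ → ℕ → ℕ → ℂ}
    (hA : A ∈ boundedCoeffs r m d) (hne : A ≠ 0) {μ : ℂ} (hμ : coeffShift lam A = μ • A) :
    ∃ l₀ < m, ∀ i l j, (l ≠ l₀ ∨ j ≠ 0) → A i l j = 0 := by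
  have heq (i l j : ℕ) : lam l * A i l j + (j + 1) * A i l (j + 1) = μ * A i l j :=
    congrFun (congrFun (congrFun hμ i) l) j
  have hvanish (l : ℕ) (hl : lam l ≠ μ) (i j : ℕ) : A i l j = 0 := by
    by_cases hj : j ≤ d + 1
    · induction hj using Nat.decreasingInduction with
      | self => exact hA _ _ _ (by omega)
      | of_succ j _ ih =>
        have h := heq i l j
        rw [ih, mul_zero, add_zero] at h
        by_contra h0
        exact hl (mul_right_cancel₀ h0 h)
    · exact hA _ _ _ (by omega)
  obtain ⟨i₀, l₀, j₀, h₀⟩ : ∃ i l j, A i l j ≠ 0 := by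
    by_contra! h
    exact hne (by ext i l j; exact h i l j)
  have hl₀ : l₀ < m := by
    by_contra h
    exact h₀ (hA _ _ _ (by omega))
  have hμ₀ : lam l₀ = μ := by
    by_contra h
    exact h₀ (hvanish l₀ h i₀ j₀)
  refine ⟨l₀, hl₀, fun i l j h => ?_⟩
  by_cases hl : l = l₀
  · subst hl
    obtain ⟨j, rfl⟩ := Nat.exists_eq_succ_of_ne_zero (h.resolve_left (not_not.2 rfl))
    have h1 := heq i l j
    rw [hμ₀, add_eq_left] at h1
    exact (mul_eq_zero.1 h1).resolve_left (Nat.cast_add_one_ne_zero j)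
  · by_cases hm : l < m
    · exact hvanish l (hμ₀ ▸ hlam l hm l₀ hl₀ hl) i j
    · exact hA _ _ _ (by omega)

/-- The linear combination of the functions `e i l j` with coefficients `A i l j`. -/
def evalCoeffs (r m d : ℕ) (e : ℕ → ℕ → ℕ → ℂ → ℂ) (A : ℕ → ℕ → ℕ → ℂ) (x : ℂ) : ℂ :=
  ∑ i ∈ Finset.range r, ∑ l ∈ Finset.range m, ∑ j ∈ Finset.range (d + 1), A i l j * e i l j x

/-- The bounded coefficient families whose associated function vanishes on `U`. -/
def coeffRelations (U : Set ℂ) (r m d : ℕ) (e : ℕ → ℕ → ℕ → ℂ → ℂ) :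
    Submodule ℂ (boundedCoeffs r m d) where
  carrier := {A | ∀ x ∈ U, evalCoeffs r m d e A x = 0}
  add_mem' {A B} hA hB x hx := by
    have h1 := hA x hx
    have h2 := hB x hx
    simp only [evalCoeffs] at h1 h2 ⊢
    simp [add_mul, Finset.sum_add_distrib, h1, h2]
  zero_mem' x hx := by simp [evalCoeffs]
  smul_mem' c A hA x hx := by
    have h1 := hA x hx
    simp only [evalCoeffs] at h1 ⊢
    simp [mul_assoc, ← Finset.mul_sum, h1]

theorem evalCoeffs_coeffShift {r m d : ℕ} (lam : ℕ → ℂ) (e : ℕ → ℕ → ℕ → ℂ → ℂ)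
    {A : ℕ → ℕ → ℕ → ℂ} (hA : A ∈ boundedCoeffs r m d) (x : ℂ) :
    evalCoeffs r m d e (coeffShift lam A) x
      = evalCoeffs r m d (fun i l j x => lam l * e i l j x + j * e i l (j - 1) x) A x := by
  refine Finset.sum_congr rfl fun i _ => Finset.sum_congr rfl fun l _ => ?_
  simp only [coeffShift, LinearMap.coe_mk, AddHom.coe_mk, add_mul, mul_add,
    Finset.sum_add_distrib]
  congr 1
  · exact Finset.sum_congr rfl fun j _ => by ring
  · rw [← Finset.sum_add_distrib, Finset.sum_range_succ, hA i l (d + 1) (by omega),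
      Finset.sum_range_succ' (fun j => A i l j * (j * e i l (j - 1) x))]
    simp only [mul_zero, zero_mul, add_zero, Nat.cast_zero, Nat.add_sub_cancel]
    exact Finset.sum_congr rfl fun j _ => by push_cast; ring


theorem coeffRelations_eq_bot {U : Set ℂ} {r m d : ℕ} {e : ℕ → ℕ → ℕ → ℂ → ℂ} {lam : ℕ → ℂ}
    (hlam : ∀ l < m, ∀ l' < m, l ≠ l' → lam l ≠ lam l')
    (hinv : ∀ A ∈ boundedCoeffs r m d, (∀ x ∈ U, evalCoeffs r m d e A x = 0) →
      ∀ x ∈ U, evalCoeffs r m d e (coeffShift lam A) x = 0)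
    (hind : ∀ l < m, ∀ c : ℕ → ℂ,
      (∀ x ∈ U, ∑ i ∈ Finset.range r, c i * e i l 0 x = 0) → ∀ i < r, c i = 0) :
    coeffRelations U r m d e = ⊥ := by
  by_contra hbot
  have : Nontrivial (coeffRelations U r m d e) := Submodule.nontrivial_iff_ne_bot.2 hbot
  let T : Module.End ℂ (coeffRelations U r m d e) :=
    ((coeffShift lam).restrict fun _ => coeffShift_mem_boundedCoeffs lam).restrict
      fun A hA => hinv A.1 A.2 hA
  obtain ⟨μ, hμ⟩ := Module.End.exists_eigenvalue (K := ℂ) (V := coeffRelations U r m d e) T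
  obtain ⟨v, hv⟩ := hμ.exists_hasEigenvector
  have hTv : coeffShift lam v.1.1 = μ • v.1.1 :=
    congrArg (fun w : coeffRelations U r m d e => w.1.1) hv.apply_eq_smul
  have hv0 : v.1.1 ≠ 0 := fun h => hv.2 (Subtype.ext (Subtype.ext h))
  obtain ⟨l₀, hl₀, hsupp⟩ := exists_forall_ne_of_coeffShift_eq_smul hlam v.1.2 hv0 hTv
  have hz := hind l₀ hl₀ (fun i => v.1.1 i l₀ 0) fun x hx => by
    rw [← v.2 x hx]
    refine Finset.sum_congr rfl fun i _ => ?_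
    rw [Finset.sum_eq_single_of_mem l₀ (Finset.mem_range.2 hl₀), Finset.sum_eq_single_of_mem 0
      (Finset.mem_range.2 d.succ_pos)]
    · intro j _ hj
      rw [hsupp i l₀ j (Or.inr hj), zero_mul]
    · intro l _ hl
      exact Finset.sum_eq_zero fun j _ => by rw [hsupp i l j (Or.inl hl), zero_mul]
  refine hv0 ?_
  ext i l j
  by_cases h : l ≠ l₀ ∨ j ≠ 0
  · exact hsupp i l j h
  · push Not at h
    obtain ⟨rfl, rfl⟩ := h
    by_cases hi : i < r
    · exact hz i hi
    · exact v.1.2 i l 0 (by omega)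

theorem statement9 (U V : Set ℂ) (hU : IsOpen U) (hV : IsOpen V)
    (r : ℕ) (hr : 1 ≤ r)
    (b : ℕ → ℂ → ℂ) (hb : ∀ k ≤ r, DifferentiableOn ℂ (b k) U)
    (hbr : ∀ x ∈ U, b r x ≠ 0)
    (ψ : ℕ → ℂ × ℂ → ℂ)
    (hψ : ∀ i < r, DifferentiableOn ℂ (ψ i) (U ×ˢ V))
    (heig : ∀ i < r, ∀ x ∈ U, ∀ z ∈ V,
      ∑ k ∈ Finset.range (r + 1), b k x * iteratedDeriv k (fun t => ψ i (t, z)) x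
        = z * ψ i (x, z))
    (hind : ∀ lam ∈ V, ∀ c : ℕ → ℂ,
      (∀ x ∈ U, ∑ i ∈ Finset.range r, c i * ψ i (x, lam) = 0) → ∀ i < r, c i = 0) :
    ∀ (m : ℕ) (lam : ℕ → ℂ), (∀ l < m, lam l ∈ V) →
      (∀ l < m, ∀ l' < m, l ≠ l' → lam l ≠ lam l') →
      ∀ (d : ℕ) (A : ℕ → ℕ → ℕ → ℂ),
        (∀ x ∈ U, ∑ i ∈ Finset.range r, ∑ l ∈ Finset.range m, ∑ j ∈ Finset.range (d + 1),
            A i l j * iteratedDeriv j (fun w => ψ i (x, w)) (lam l) = 0) →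
        ∀ i < r, ∀ l < m, ∀ j ≤ d, A i l j = 0 := by
  intro m lam hlamV hlam d A hA
  let e : ℕ → ℕ → ℕ → ℂ → ℂ := fun i l j x => iteratedDeriv j (fun w => ψ i (x, w)) (lam l)
  have hhol (i : ℕ) (hi : i < r) : SeparatelyHolomorphic U V (fun x z => ψ i (x, z)) :=
    .of_differentiableOn hU hV (hψ i hi)
  have hcd (i : ℕ) (hi : i < r) (l : ℕ) (hl : l < m) (j n : ℕ) (x : ℂ) (hx : x ∈ U) :
      ContDiffAt ℂ n (e i l j) x := by
    have h := ((hhol i hi).iterate_partialRight hU hV j).contDiffAt_left hU hx (hlamV l hl)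
      (n := n)
    simpa only [partialRight_iterate] using h
  have hinv : ∀ B ∈ boundedCoeffs r m d, (∀ x ∈ U, evalCoeffs r m d e B x = 0) →
      ∀ x ∈ U, evalCoeffs r m d e (coeffShift lam B) x = 0 := by
    intro B hB hB0 x hx
    have hzero (k : ℕ) : iteratedDeriv k (evalCoeffs r m d e B) x = 0 := by
      have : evalCoeffs r m d e B =ᶠ[𝓝 x] fun _ => (0 : ℂ) := by
        filter_upwards [hU.mem_nhds hx] with y hy using hB0 y hy
      rw [this.iteratedDeriv_eq k]
      simp
    have hexp (k : ℕ) : iteratedDeriv k (evalCoeffs r m d e B) x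
        = evalCoeffs r m d (fun i l j => iteratedDeriv k (e i l j)) B x := by
      have hterm : ∀ i ∈ Finset.range r, ∀ l ∈ Finset.range m, ∀ j ∈ Finset.range (d + 1),
          ContDiffAt ℂ k (fun x => B i l j * e i l j x) x := fun i hi l hl j _ =>
        contDiffAt_const.mul
          (hcd i (Finset.mem_range.1 hi) l (Finset.mem_range.1 hl) j k x hx)
      unfold evalCoeffs
      rw [iteratedDeriv_fun_sum fun i hi =>
        ContDiffAt.sum fun l hl => ContDiffAt.sum fun j hj => hterm i hi l hl j hj]
      refine Finset.sum_congr rfl fun i hi => ?_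
      rw [iteratedDeriv_fun_sum fun l hl => ContDiffAt.sum fun j hj => hterm i hi l hl j hj]
      refine Finset.sum_congr rfl fun l hl => ?_
      rw [iteratedDeriv_fun_sum (hterm i hi l hl)]
      exact Finset.sum_congr rfl fun j _ => iteratedDeriv_const_mul_field _ _
    rw [evalCoeffs_coeffShift lam e hB]
    calc _ = ∑ k ∈ Finset.range (r + 1),
          b k x * evalCoeffs r m d (fun i l j => iteratedDeriv k (e i l j)) B x := by
          simp only [evalCoeffs, Finset.mul_sum]
          symm
          refine Finset.sum_comm.trans ?_
          refine Finset.sum_congr rfl fun i hi => ?_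
          refine Finset.sum_comm.trans ?_
          refine Finset.sum_congr rfl fun l hl => ?_
          refine Finset.sum_comm.trans ?_
          refine Finset.sum_congr rfl fun j _ => ?_
          rw [← (hhol i (Finset.mem_range.1 hi)).sum_mul_iteratedDeriv_iteratedDeriv hU hV
            (heig i (Finset.mem_range.1 hi)) hx (hlamV l (Finset.mem_range.1 hl)) j,
            Finset.mul_sum]
          exact Finset.sum_congr rfl fun k _ => mul_left_comm _ _ _
      _ = 0 := Finset.sum_eq_zero fun k _ => by rw [← hexp, hzero, mul_zero]
  have hbot : coeffRelations U r m d e = ⊥ := by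
    refine coeffRelations_eq_bot hlam hinv fun l hl c hc => hind (lam l) (hlamV l hl) c ?_
    simpa only [e, iteratedDeriv_zero] using hc
  let A' : boundedCoeffs r m d :=
    ⟨fun i l j => if i < r ∧ l < m ∧ j ≤ d then A i l j else 0, fun i l j h => if_neg h⟩
  have hA' : A' ∈ coeffRelations U r m d e := by
    intro x hx
    rw [← hA x hx]
    refine Finset.sum_congr rfl fun i hi => Finset.sum_congr rfl fun l hl =>
      Finset.sum_congr rfl fun j hj => ?_
    rw [Finset.mem_range] at hi hl hj
    simp only [A', e, if_pos (And.intro hi (And.intro hl (Nat.le_of_lt_succ hj)))]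
  rw [hbot, Submodule.mem_bot] at hA'
  intro i hi l hl j hj
  have h := congrFun (congrFun (congrFun (congrArg Subtype.val hA') i) l) j
  simpa [A', hi, hl, hj] using h
end

section
/- Let 𝒱 denote the ℂ-span of φ_1, …, φ_N inside the space of entire functions, and for a polynomial p(z) = Σ_k p_k·z^k let p(L₀) denote the operator u ↦ Σ_k p_k·(L₀^k u) on entire functions. Then for every p ∈ ℂ[z]: p(L₀) maps 𝒱 into 𝒱 if and only if p′(λ_i) = 0 for all i = 1, …, n. In particular there exist nonconstant polynomials p (for example p(z) = ∏_{i=1}^n (z−λ_i)²) with p(L₀)(𝒱) ⊆ 𝒱, so the ring R_{K̄,L₀} = R_C = {p ∈ ℂ[z] : p′(λ_i) = 0 for all i} is nontrivial. -/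
open scoped BigOperators

noncomputable def polyOpAiry (r : ℕ) (a : ℕ → ℂ) (p : Polynomial ℂ) (u : ℂ → ℂ) : ℂ → ℂ :=
  fun x => ∑ k ∈ Finset.range (p.natDegree + 1), p.coeff k * (airyOp r a)^[k] u x

section Jordan

open Polynomial

theorem eval_derivative_prod_sq {ι R : Type*} [CommRing R]
    (s : Finset ι) (c : ι → R) {i : ι} (hi : i ∈ s) :
    (derivative (∏ k ∈ s, (X - C (c k)) ^ 2)).eval (c i) = 0 := by
  obtain ⟨q, hq⟩ := Finset.dvd_prod_of_mem (fun k => (X - C (c k)) ^ 2) hi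
  rw [hq]
  simp [derivative_mul, derivative_pow]

variable {K M : Type*} [Field K] [AddCommGroup M] [Module K M]

theorem aeval_apply_of_apply_eq_smul {L : Module.End K M} {μ : K} {g : M} (hg : L g = μ • g)
    (p : K[X]) : aeval L p g = p.eval μ • g := by
  induction p using Polynomial.induction_on with
  | C c => simp [Module.algebraMap_end_apply]
  | add p q hp hq => simp [hp, hq, add_smul]
  | monomial k c ih =>
    rw [pow_succ, ← mul_assoc, mul_comm _ X, map_mul, Module.End.mul_apply, ih]
    simp only [aeval_X, map_smul, hg, smul_smul, eval_mul, eval_X]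
    congr 1; ring

theorem aeval_apply_of_apply_eq_smul_add {L : Module.End K M} {μ : K} {g v : M}
    (hg : L g = μ • g) (hv : L v = μ • v + g) (p : K[X]) :
    aeval L p v = p.eval μ • v + (derivative p).eval μ • g := by
  induction p using Polynomial.induction_on with
  | C c => simp [Module.algebraMap_end_apply]
  | add p q hp hq => simp only [map_add, LinearMap.add_apply, hp, hq, eval_add]; module
  | monomial k c ih =>
    rw [pow_succ, ← mul_assoc, mul_comm _ X, map_mul, Module.End.mul_apply, ih]
    simp only [aeval_X, map_add, map_smul, hg, hv, eval_mul, eval_X, derivative_mul,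
      derivative_X, eval_add, one_mul]
    module

variable {ι κ : Type*} [Fintype ι] [Fintype κ] {L : Module.End K M} {μ : ι → K} {g v : ι → κ → M}

/-- An eigenvector of a Jordan block of height two is not a combination of the cyclic vectors. -/
theorem notMem_span_of_jordan (hμ : Function.Injective μ) (hg : ∀ i j, L (g i j) = μ i • g i j)
    (hv : ∀ i j, L (v i j) = μ i • v i j + g i j) (hli : ∀ i, LinearIndependent K (g i))
    (i : ι) (j : κ) : g i j ∉ Submodule.span K (Set.range fun s : ι × κ => v s.1 s.2) := by
  classical
  intro hmem
  obtain ⟨c, hc⟩ := (Submodule.mem_span_range_iff_exists_fun K).1 hmem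
  rw [Fintype.sum_prod_type] at hc
  set q : K[X] := ∏ k ∈ Finset.univ.erase i, (X - C (μ k)) ^ 2
  have hqi : q.eval (μ i) ≠ 0 := by
    rw [eval_prod]
    refine Finset.prod_ne_zero_iff.2 fun k hk => ?_
    simpa [sub_eq_zero] using fun h => (Finset.ne_of_mem_erase hk) (hμ h).symm
  have hdvd : ∀ k, k ≠ i → (X - C (μ k)) ^ 2 ∣ q := fun k hk =>
    Finset.dvd_prod_of_mem (fun k => (X - C (μ k)) ^ 2) (by simpa using hk)
  have hkill : ∀ (p : K[X]) k, (X - C (μ k)) ^ 2 ∣ p → ∀ l, aeval L p (v k l) = 0 := by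
    rintro p k ⟨s, rfl⟩ l
    rw [aeval_apply_of_apply_eq_smul_add (hg k l) (hv k l)]
    simp [derivative_mul, derivative_pow]
  have hreduce : ∀ p : K[X], q ∣ p → ∑ l, c (i, l) • aeval L p (v i l) = aeval L p (g i j) := by
    intro p hp
    rw [← hc, map_sum, Finset.sum_eq_single i]
    · simp
    · intro k _ hk
      simp [hkill p k ((hdvd k hk).trans hp)]
    · simp
  have hc0 : ∀ l, c (i, l) = 0 := by
    have h := hreduce ((X - C (μ i)) * q) (Dvd.intro_left _ rfl)
    simp only [aeval_apply_of_apply_eq_smul_add (hg i _) (hv i _),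
      aeval_apply_of_apply_eq_smul (hg i _), derivative_mul, eval_mul, eval_add, eval_sub, eval_X,
      eval_C, sub_self, zero_mul, zero_smul, zero_add, derivative_sub, derivative_X, derivative_C,
      sub_zero, one_mul, add_zero, smul_comm _ (q.eval (μ i)), ← Finset.smul_sum,
      smul_eq_zero, hqi, false_or] at h
    exact Fintype.linearIndependent_iff.1 (hli i) _ h
  have h := hreduce q dvd_rfl
  simp only [hc0, zero_smul, Finset.sum_const_zero, aeval_apply_of_apply_eq_smul (hg i _)] at h
  exact (smul_ne_zero hqi ((hli i).ne_zero j)) h.symm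

theorem aeval_mapsTo_span_iff_of_jordan [Nonempty κ] (hμ : Function.Injective μ)
    (hg : ∀ i j, L (g i j) = μ i • g i j) (hv : ∀ i j, L (v i j) = μ i • v i j + g i j)
    (hli : ∀ i, LinearIndependent K (g i)) (p : K[X]) :
    (∀ w ∈ Submodule.span K (Set.range fun s : ι × κ => v s.1 s.2),
        aeval L p w ∈ Submodule.span K (Set.range fun s : ι × κ => v s.1 s.2)) ↔
      ∀ i, (derivative p).eval (μ i) = 0 := by
  have hmem : ∀ i j, v i j ∈ Submodule.span K (Set.range fun s : ι × κ => v s.1 s.2) :=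
    fun i j => Submodule.subset_span ⟨(i, j), rfl⟩
  constructor
  · intro h i
    obtain ⟨j⟩ := ‹Nonempty κ›
    by_contra hne
    have h1 := h _ (hmem i j)
    rw [aeval_apply_of_apply_eq_smul_add (hg i j) (hv i j),
      Submodule.add_mem_iff_right _ (Submodule.smul_mem _ _ (hmem i j)),
      Submodule.smul_mem_iff _ hne] at h1
    exact notMem_span_of_jordan hμ hg hv hli i j h1
  · intro h
    change _ ≤ (Submodule.span K _).comap (aeval L p)
    rw [Submodule.span_le]
    rintro _ ⟨⟨i, j⟩, rfl⟩
    simp only [SetLike.mem_coe, Submodule.mem_comap,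
      aeval_apply_of_apply_eq_smul_add (hg i j) (hv i j), h i, zero_smul, add_zero]
    exact Submodule.smul_mem _ _ (hmem i j)

end Jordan

open scoped Polynomial
open Polynomial (aeval C X)

theorem commute_pow_sub_sum {K A : Type*} [CommRing K] [Ring A] [Algebra K A] {x y : A}
    (h : Commute x y) (r : ℕ) (a : ℕ → K) (s : Finset ℕ) :
    Commute (x ^ r - ∑ k ∈ s, a k • x ^ k) y :=
  (h.pow_left r).sub_left (Commute.sum_left _ _ _ fun k _ => (h.pow_left k).smul_left (a k))

/-- The space of entire functions. -/
def entireFunctions : Submodule ℂ (ℂ → ℂ) where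
  carrier := {u | Differentiable ℂ u}
  add_mem' hu hv := hu.add hv
  zero_mem' := differentiable_const 0
  smul_mem' c _ hu := hu.const_smul c

namespace entireFunctions

theorem differentiable (u : entireFunctions) : Differentiable ℂ (u : ℂ → ℂ) := u.2

/-- This shortcut lets ring lemmas rewrite in `Module.End ℂ entireFunctions`. -/
instance : AddCommGroup entireFunctions := Submodule.addCommGroup _

/-- Differentiation of entire functions. -/
noncomputable def D : Module.End ℂ entireFunctions where
  toFun u := ⟨deriv u, (differentiable u).deriv⟩
  map_add' u v := Subtype.ext <| funext fun x =>
    deriv_add (differentiable u x) (differentiable v x)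
  map_smul' c u := Subtype.ext <| funext fun x => deriv_const_smul c (differentiable u x)

/-- Multiplication of entire functions by the variable. -/
def mulVar : Module.End ℂ entireFunctions where
  toFun u := ⟨fun x => x * u.1 x, differentiable_id.mul (differentiable u)⟩
  map_add' u v := Subtype.ext <| funext fun x => mul_add x (u.1 x) (v.1 x)
  map_smul' c u := Subtype.ext <| funext fun x => mul_left_comm x c (u.1 x)

/-- Translation of entire functions. -/
def translate (l : ℂ) : Module.End ℂ entireFunctions where
  toFun u := ⟨fun x => u.1 (x + l), (differentiable u).comp (differentiable_id.add_const l)⟩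
  map_add' _ _ := rfl
  map_smul' _ _ := rfl

theorem D_mul_mulVar : D * mulVar = mulVar * D + 1 := by
  ext u x
  change deriv (fun y => y * u.1 y) x = x * deriv u.1 x + u.1 x
  rw [deriv_fun_mul differentiableAt_fun_id (differentiable u x), deriv_id'']
  ring

theorem commute_D_translate (l : ℂ) : Commute D (translate l) := by
  ext u x
  exact deriv_comp_add_const u.1 l x

theorem mulVar_mul_translate (l : ℂ) :
    mulVar * translate l = translate l * mulVar - l • translate l := by
  ext u x
  change x * u.1 (x + l) = (x + l) * u.1 (x + l) - l * u.1 (x + l)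
  ring

theorem coe_D_pow (k : ℕ) (u : entireFunctions) : ((D ^ k) u : ℂ → ℂ) = iteratedDeriv k u := by
  induction k with
  | zero => simp
  | succ k ih => rw [pow_succ', iteratedDeriv_succ, ← ih]; rfl

/-- The generalized Airy operator on entire functions. -/
noncomputable def airy (r : ℕ) (a : ℕ → ℂ) : Module.End ℂ entireFunctions :=
  D ^ r - ∑ k ∈ Finset.Ico 1 (r - 1), a k • D ^ k - mulVar

theorem coe_airy (r : ℕ) (a : ℕ → ℂ) (u : entireFunctions) :
    (airy r a u : ℂ → ℂ) = airyOp r a u := by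
  ext x
  simp only [airy, airyOp, ← coe_D_pow, LinearMap.sub_apply, LinearMap.sum_apply,
    LinearMap.smul_apply, Submodule.coe_sub, Submodule.coe_sum, Submodule.coe_smul, Pi.sub_apply,
    Finset.sum_apply, Pi.smul_apply, smul_eq_mul]
  rfl

theorem coe_airy_pow (r : ℕ) (a : ℕ → ℂ) (k : ℕ) (u : entireFunctions) :
    ((airy r a ^ k) u : ℂ → ℂ) = (airyOp r a)^[k] u := by
  induction k with
  | zero => rfl
  | succ k ih => rw [pow_succ', Function.iterate_succ_apply', ← ih, ← coe_airy]; rfl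

theorem coe_aeval_airy (r : ℕ) (a : ℕ → ℂ) (p : ℂ[X]) (u : entireFunctions) :
    (aeval (airy r a) p u : ℂ → ℂ) = polyOpAiry r a p u := by
  ext x
  simp [polyOpAiry, Polynomial.aeval_eq_sum_range, ← coe_airy_pow]

theorem airy_mul_D (r : ℕ) (a : ℕ → ℂ) : airy r a * D = D * airy r a + 1 := by
  rw [airy, sub_mul, mul_sub, (commute_pow_sub_sum (Commute.refl D) r a _).eq, D_mul_mulVar]
  abel

theorem airy_mul_translate (r : ℕ) (a : ℕ → ℂ) (l : ℂ) :
    airy r a * translate l = translate l * airy r a + l • translate l := by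
  rw [airy, sub_mul, mul_sub, (commute_pow_sub_sum (commute_D_translate l) r a _).eq,
    mulVar_mul_translate]
  abel

theorem airy_translate_of_airy_eq_zero {r : ℕ} {a : ℕ → ℂ} {u : entireFunctions}
    (hu : airy r a u = 0) (l : ℂ) : airy r a (translate l u) = l • translate l u := by
  simpa [hu] using LinearMap.congr_fun (airy_mul_translate r a l) u

theorem airy_smul_add_D {r : ℕ} {a : ℕ → ℂ} {l : ℂ} {u : entireFunctions}
    (hu : airy r a u = l • u) (c : ℂ) : airy r a (c • u + D u) = l • (c • u + D u) + u := by
  have h := LinearMap.congr_fun (airy_mul_D r a) u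
  simp only [Module.End.mul_apply, LinearMap.add_apply, Module.End.one_apply, hu, map_smul] at h
  rw [map_add, map_smul, hu, h]
  module

theorem linearIndependent_of_wrDet_ne_zero {m : ℕ} {u : Fin m → entireFunctions} {x : ℂ}
    (h : wrDet m (fun j => u j) x ≠ 0) : LinearIndependent ℂ u := by
  rw [Fintype.linearIndependent_iff]
  intro c hc
  refine congrFun (Matrix.eq_zero_of_mulVec_eq_zero h ?_)
  ext k
  have hk := congrFun (congrArg (fun w => ((D ^ k.val) w : ℂ → ℂ)) hc) x
  simp only [map_sum, map_smul, Submodule.coe_sum, Submodule.coe_smul, Finset.sum_apply,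
    Pi.smul_apply, coe_D_pow, smul_eq_mul, map_zero, ZeroMemClass.coe_zero] at hk
  simpa [Matrix.mulVec, dotProduct, mul_comm] using hk

theorem translate_injective (l : ℂ) : Function.Injective (translate l) := by
  intro u v h
  ext x
  simpa [translate] using congrFun (congrArg Subtype.val h) (x - l)

end entireFunctions

theorem range_phiFam (r n : ℕ) (f : ℕ → ℂ → ℂ) (lam gam : ℕ → ℂ) :
    Set.range (phiFam r n f lam gam) = Set.range fun s : Fin n × Fin r => fun x =>
      gam s.1 * f s.2 (x + lam s.1) + deriv (f s.2) (x + lam s.1) := by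
  rw [← (finProdFinEquiv.trans (finCongr (mul_comm n r))).surjective.range_comp]
  congr 1
  ext ⟨i, j⟩ x
  have hr : 0 < r := j.pos
  simp [phiFam, finProdFinEquiv, Nat.add_mul_div_left _ _ hr, Nat.div_eq_of_lt j.2,
    Nat.mod_eq_of_lt j.2]

theorem statement12 (r n : ℕ) (a : ℕ → ℂ) (f : ℕ → ℂ → ℂ) (lam gam : ℕ → ℂ)
    (hr : 2 ≤ r) (hn : 1 ≤ n)
    (hf : ∀ j < r, Differentiable ℂ (f j))
    (hker : ∀ j < r, ∀ x : ℂ, airyOp r a (f j) x = 0)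
    (hwrf : ∀ x : ℂ, wrDet r (fun j => f j.val) x = 1)
    (hlam : ∀ i < n, ∀ j < n, i ≠ j → lam i ≠ lam j) :
    (∀ p : Polynomial ℂ,
      (∀ v ∈ Submodule.span ℂ (Set.range (phiFam r n f lam gam)),
          polyOpAiry r a p v ∈ Submodule.span ℂ (Set.range (phiFam r n f lam gam)))
        ↔ ∀ i < n, (Polynomial.derivative p).eval (lam i) = 0) ∧
    ∃ p : Polynomial ℂ, 0 < p.degree ∧
      ∀ v ∈ Submodule.span ℂ (Set.range (phiFam r n f lam gam)),
        polyOpAiry r a p v ∈ Submodule.span ℂ (Set.range (phiFam r n f lam gam)) := by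
  let F : Fin r → entireFunctions := fun j => ⟨f j, hf j j.2⟩
  let g : Fin n → Fin r → entireFunctions := fun i j =>
    entireFunctions.translate (lam i) (F j)
  let φ : Fin n → Fin r → entireFunctions := fun i j =>
    gam i • g i j + entireFunctions.D (g i j)
  have hF : ∀ j, entireFunctions.airy r a (F j) = 0 := fun j =>
    Subtype.ext <| (entireFunctions.coe_airy r a (F j)).trans (funext (hker j j.2))
  have hg : ∀ i j, entireFunctions.airy r a (g i j) = lam i • g i j := fun i j =>
    entireFunctions.airy_translate_of_airy_eq_zero (hF j) (lam i)
  have hφ : ∀ i j, entireFunctions.airy r a (φ i j) = lam i • φ i j + g i j := fun i j =>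
    entireFunctions.airy_smul_add_D (hg i j) (gam i)
  have hFli : LinearIndependent ℂ F :=
    entireFunctions.linearIndependent_of_wrDet_ne_zero (x := 0)
      ((hwrf 0).trans_ne one_ne_zero)
  have hli : ∀ i, LinearIndependent ℂ (g i) := fun i =>
    hFli.map' _ (LinearMap.ker_eq_bot.2 (entireFunctions.translate_injective (lam i)))
  have hinj : Function.Injective fun i : Fin n => lam i := fun i j h => by
    by_contra hne
    exact hlam i i.2 j j.2 (fun h => hne (Fin.ext h)) h
  have : Nonempty (Fin r) := ⟨⟨0, by omega⟩⟩
  have hspan : Submodule.span ℂ (Set.range (phiFam r n f lam gam)) =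
      (Submodule.span ℂ (Set.range fun s : Fin n × Fin r => φ s.1 s.2)).map
        entireFunctions.subtype := by
    rw [Submodule.map_span, ← Set.range_comp, range_phiFam]
    congr 2
    ext s x
    exact congrArg _ (deriv_comp_add_const (f s.2) (lam s.1) x).symm
  have key : ∀ p : Polynomial ℂ,
      (∀ v ∈ Submodule.span ℂ (Set.range (phiFam r n f lam gam)),
          polyOpAiry r a p v ∈ Submodule.span ℂ (Set.range (phiFam r n f lam gam)))
        ↔ ∀ i < n, (Polynomial.derivative p).eval (lam i) = 0 := by
    intro p
    have h := aeval_mapsTo_span_iff_of_jordan hinj hg hφ hli p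
    rw [Fin.forall_iff] at h
    rw [← h, hspan]
    simp only [Submodule.mem_map, forall_exists_index, and_imp, forall_apply_eq_imp_iff₂,
      Submodule.subtype_apply, ← entireFunctions.coe_aeval_airy, Subtype.coe_inj, exists_eq_right]
  refine ⟨key, ∏ i ∈ Finset.range n, (X - C (lam i)) ^ 2, ?_, (key _).2 fun i hi =>
    eval_derivative_prod_sq _ lam (Finset.mem_range.2 hi)⟩
  rw [← Polynomial.natDegree_pos_iff_degree_pos,
    Polynomial.natDegree_prod_of_monic _ _ fun i _ => (Polynomial.monic_X_sub_C (lam i)).pow 2]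
  simp only [Polynomial.natDegree_pow, Polynomial.natDegree_X_sub_C, Finset.sum_const,
    Finset.card_range, smul_eq_mul]
  omega
end

section
/- For p ∈ ℂ[z] the following are equivalent: (i) for every c ∈ C the linear functional g ↦ c(p·g) again belongs to C; (ii) p′(λ_i) = 0 for all i = 1, …, n. That is, the stabilizer ring R_C = {p ∈ ℂ[z] : c∘p ∈ C for all c ∈ C} equals {p ∈ ℂ[z] : p′(λ_i) = 0, 1 ≤ i ≤ n}. -/
open scoped BigOperators

theorem eval_derivative_eq_zero_of_sq_dvd {R : Type*} [CommRing R] {f : Polynomial R} {a : R}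
    (h : (Polynomial.X - Polynomial.C a) ^ 2 ∣ f) :
    f.eval a = 0 ∧ (Polynomial.derivative f).eval a = 0 := by
  obtain ⟨g, rfl⟩ := h
  constructor <;> simp [Polynomial.derivative_mul, Polynomial.derivative_pow]

/-- A polynomial killed by all the functionals `g ↦ g'(lam j) + gam j * g (lam j)`, `j ∈ s`, which
does not vanish at a prescribed node `lam i`. -/
theorem exists_eval_ne_zero_of_derivative_add_mul_eval_eq_zero {ι K : Type*} [DecidableEq ι]
    [Field K] (s : Finset ι) (lam gam : ι → K) (hlam : Set.InjOn lam s) {i : ι} (hi : i ∈ s) :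
    ∃ f : Polynomial K, f.eval (lam i) ≠ 0 ∧
      ∀ j ∈ s, (Polynomial.derivative f).eval (lam j) + gam j * f.eval (lam j) = 0 := by
  set q : Polynomial K := ∏ j ∈ s.erase i, (Polynomial.X - Polynomial.C (lam j)) ^ 2 with hq
  have hqi : q.eval (lam i) ≠ 0 := by
    rw [hq, Polynomial.eval_prod, Finset.prod_ne_zero_iff]
    intro j hj
    obtain ⟨hji, hjs⟩ := Finset.mem_erase.mp hj
    simpa [sub_eq_zero] using fun h => hji (hlam hjs hi h.symm)
  set a := -gam i - (Polynomial.derivative q).eval (lam i) / q.eval (lam i) with ha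
  refine ⟨q * (1 + Polynomial.C a * (Polynomial.X - Polynomial.C (lam i))), by simpa using hqi,
    fun j hj => ?_⟩
  by_cases hji : j = i
  · subst hji
    simp only [Polynomial.derivative_mul, Polynomial.derivative_add, Polynomial.derivative_sub,
      Polynomial.derivative_one, Polynomial.derivative_C, Polynomial.derivative_X,
      Polynomial.eval_add, Polynomial.eval_mul, Polynomial.eval_sub, Polynomial.eval_one,
      Polynomial.eval_C, Polynomial.eval_X, Polynomial.eval_zero]
    rw [ha]
    field_simp
    ring
  · obtain ⟨h₀, h₁⟩ := eval_derivative_eq_zero_of_sq_dvd (a := lam j)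
      (f := q * (1 + Polynomial.C a * (Polynomial.X - Polynomial.C (lam i))))
      ((Finset.dvd_prod_of_mem (fun j => (Polynomial.X - Polynomial.C (lam j)) ^ 2)
        (Finset.mem_erase.mpr ⟨hji, hj⟩)).mul_right _)
    rw [h₀, h₁, mul_zero, add_zero]

theorem statement13 (n : ℕ) (hn : 1 ≤ n) (lam gam : ℕ → ℂ)
    (hlam : ∀ i < n, ∀ j < n, i ≠ j → lam i ≠ lam j) (p : Polynomial ℂ) :
    (∀ c ∈ Submodule.span ℂ {c : Polynomial ℂ → ℂ | ∃ i < n,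
        c = fun g => (Polynomial.derivative g).eval (lam i) + gam i * g.eval (lam i)},
      (fun g => c (p * g)) ∈ Submodule.span ℂ {c : Polynomial ℂ → ℂ | ∃ i < n,
        c = fun g => (Polynomial.derivative g).eval (lam i) + gam i * g.eval (lam i)})
      ↔ ∀ i < n, (Polynomial.derivative p).eval (lam i) = 0 := by
  constructor
  · intro h i hi
    have hinj : Set.InjOn lam (Finset.range n) := fun a ha b hb hab => by
      by_contra hne
      exact hlam a (Finset.mem_range.mp ha) b (Finset.mem_range.mp hb) hne hab
    obtain ⟨f, hfi, hf⟩ := exists_eval_ne_zero_of_derivative_add_mul_eval_eq_zero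
      (Finset.range n) lam gam hinj (Finset.mem_range.mpr hi)
    have hker : Submodule.span ℂ {c : Polynomial ℂ → ℂ | ∃ i < n,
        c = fun g => (Polynomial.derivative g).eval (lam i) + gam i * g.eval (lam i)} ≤
        LinearMap.ker (LinearMap.proj f : (Polynomial ℂ → ℂ) →ₗ[ℂ] ℂ) := by
      rw [Submodule.span_le]
      rintro _ ⟨j, hj, rfl⟩
      exact hf j (Finset.mem_range.mpr hj)
    have hpf : (Polynomial.derivative (p * f)).eval (lam i) + gam i * (p * f).eval (lam i) = 0 :=
      hker (h _ (Submodule.subset_span ⟨i, hi, rfl⟩))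
    simp only [Polynomial.derivative_mul, Polynomial.eval_add, Polynomial.eval_mul] at hpf
    refine (mul_eq_zero.mp ?_).resolve_right hfi
    linear_combination hpf - p.eval (lam i) * hf i (Finset.mem_range.mpr hi)
  · intro h c hc
    induction hc using Submodule.span_induction with
    | mem c hc =>
      obtain ⟨i, hi, rfl⟩ := hc
      convert Submodule.smul_mem _ (p.eval (lam i))
        (Submodule.subset_span (show _ ∈ {c : Polynomial ℂ → ℂ | ∃ i < n, c = fun g =>
          (Polynomial.derivative g).eval (lam i) + gam i * g.eval (lam i)} from
            ⟨i, hi, rfl⟩)) using 1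
      ext g
      simp only [Polynomial.derivative_mul, Polynomial.eval_add, Polynomial.eval_mul, h i hi,
        Pi.smul_apply, smul_eq_mul]
      ring
    | zero => exact Submodule.zero_mem _
    | add c d _ _ hc hd => exact Submodule.add_mem _ hc hd
    | smul a c _ hc => exact Submodule.smul_mem _ a hc
end
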